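/- arXiv:0910.2506 — 2 statements merged into one kernel-verified Lean document; each statement's English description precedes it below -/
import Mathlib

section
/- Let A be a (not necessarily irreducible) Coxeter arrangement with Coxeter group W, D a primitive derivation, and m : A → ℤ an arbitrary multiplicity. Then the primitive filtration R_k^{(m)} := ∇_D^k D(A,m)^W (k ∈ ℤ) of D(A,−∞)^W is an increasing filtration ⋯ ⊂ R_{−1}^{(m)} ⊂ R_0^{(m)} ⊂ R_1^{(m)} ⊂ ⋯ and for every k ∈ ℤ one has R_k^{(m)} = R_0^{(m−2k)} = D(A, m−2k)^W. -/
open MvPolynomial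

noncomputable section CoxeterFormalization

/-! ### The ambient rings: `S = Sym(V*)`, `F = Frac(S)`, rational 1-forms.

We model the `ℓ`-dimensional Euclidean space `V` as `ℝ^ℓ` with its standard
(orthonormal) coordinates, so that `S = ℝ[x_0, …, x_{ℓ-1}]`, and a rational
differential 1-form `ω = Σ ω_x dx_x` (equivalently, a rational derivation
`ξ = Σ ξ_x ∂_x`) is recorded by its component vector `(ω_x)_x : Fin ℓ → F`. -/

abbrev Spoly (ℓ : ℕ) := MvPolynomial (Fin ℓ) ℝ
abbrev Ffield (ℓ : ℕ) := FractionRing (Spoly ℓ)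
abbrev OmF (ℓ : ℕ) := Fin ℓ → Ffield ℓ

variable {ℓ t : ℕ}

/-- The image of `S` in `F`: the "regular" (polynomial) rational functions. -/
def Sreg (ℓ : ℕ) : Set (Ffield ℓ) := Set.range (algebraMap (Spoly ℓ) (Ffield ℓ))

def toF (p : Spoly ℓ) : Ffield ℓ := algebraMap (Spoly ℓ) (Ffield ℓ) p

/-- The linear form `α = Σ a_x · x_x ∈ V*` attached to a normal vector `a`. -/
def linForm (a : Fin ℓ → ℝ) : Spoly ℓ := ∑ x, MvPolynomial.C (a x) * MvPolynomial.X x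

def linF (a : Fin ℓ → ℝ) : Ffield ℓ := toF (linForm a)

def cF (r : ℝ) : Ffield ℓ := toF (MvPolynomial.C r)

def XF (x : Fin ℓ) : Ffield ℓ := toF (MvPolynomial.X x)

/-- `Q = ∏_{H ∈ A} α_H`, as an element of `F`. -/
def QF (A : Finset (Fin ℓ → ℝ)) : Ffield ℓ := toF (∏ a ∈ A, linForm a)

/-- `Q^m = ∏_{H ∈ A} α_H^{m(H)}` for an integral multiplicity `m`. -/
def QmF (A : Finset (Fin ℓ → ℝ)) (m : (Fin ℓ → ℝ) → ℤ) : Ffield ℓ :=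
  ∏ a ∈ A, linF a ^ m a

/-- Ziegler's module `Ω(A,∞)` of logarithmic 1-forms:
`Q^N ω` and `(Q/α_H)^N dα_H ∧ ω` regular for `N ≫ 0`.  The wedge
`dα_H ∧ ω` is recorded by its components `a_x ω_y - a_y ω_x`. -/
def OmegaInf (A : Finset (Fin ℓ → ℝ)) : Set (OmF ℓ) :=
  {ω | ∃ N : ℕ,
    (∀ x, QF A ^ N * ω x ∈ Sreg ℓ) ∧
    ∀ a ∈ A, ∀ x y,
      (QF A / linF a) ^ N * (cF (a x) * ω y - cF (a y) * ω x) ∈ Sreg ℓ}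

/-- `Ω(A,m)` for an arbitrary multiplicity `m : A → ℤ`: those `ω ∈ Ω(A,∞)` with
`(Q/α_H)^N α_H^{m(H)} I*(dα_H, ω) ∈ S` for `N ≫ 0`; here
`I*(dα_H, ω) = Σ_x a_x ω_x` (the coordinates are orthonormal). -/
def OmegaMult (A : Finset (Fin ℓ → ℝ)) (m : (Fin ℓ → ℝ) → ℤ) : Set (OmF ℓ) :=
  {ω ∈ OmegaInf A | ∃ N : ℕ,
    ∀ a ∈ A, (QF A / linF a) ^ N * linF a ^ m a * (∑ x, cF (a x) * ω x) ∈ Sreg ℓ}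

/-! ### The action of `GL_ℓ(ℝ)` on `S`, `F` and on component vectors. -/

/-- Substitution `x_i ↦ Σ_j M_{i j} x_j`, i.e. `f ↦ f ∘ M`. -/
def matSub (M : Matrix (Fin ℓ) (Fin ℓ) ℝ) : Spoly ℓ →ₐ[ℝ] Spoly ℓ :=
  MvPolynomial.aeval fun x => ∑ y, MvPolynomial.C (M x y) * MvPolynomial.X y

lemma matSub_comp (M N : Matrix (Fin ℓ) (Fin ℓ) ℝ) :
    (matSub M).comp (matSub N) = matSub (N * M) := by
  apply MvPolynomial.algHom_ext
  intro x
  simp only [matSub, AlgHom.coe_comp, Function.comp_apply, aeval_X, map_sum, map_mul, aeval_C,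
    Matrix.mul_apply, C_mul, Finset.sum_mul, Finset.mul_sum, MvPolynomial.algebraMap_eq,
    mul_assoc]
  rw [Finset.sum_comm]

lemma matSub_one : matSub (1 : Matrix (Fin ℓ) (Fin ℓ) ℝ) = AlgHom.id ℝ (Spoly ℓ) := by
  apply MvPolynomial.algHom_ext
  intro x
  simp [matSub, Matrix.one_apply, apply_ite MvPolynomial.C, ite_mul, Finset.sum_ite_eq]

lemma matSub_injective (g : Matrix.GeneralLinearGroup (Fin ℓ) ℝ) :
    Function.Injective (matSub (↑g : Matrix (Fin ℓ) (Fin ℓ) ℝ)) := by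
  intro p q h
  have h3 : (matSub (↑g⁻¹ : Matrix (Fin ℓ) (Fin ℓ) ℝ)).comp
      (matSub (↑g : Matrix (Fin ℓ) (Fin ℓ) ℝ)) = AlgHom.id ℝ (Spoly ℓ) := by
    rw [matSub_comp]
    have h1 : ((↑g : Matrix (Fin ℓ) (Fin ℓ) ℝ) * (↑g⁻¹ : Matrix (Fin ℓ) (Fin ℓ) ℝ))
        = (1 : Matrix (Fin ℓ) (Fin ℓ) ℝ) := by
      rw [← Units.val_mul]; simp
    rw [h1, matSub_one]
  have h2 := congrArg (matSub (↑g⁻¹ : Matrix (Fin ℓ) (Fin ℓ) ℝ)) h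
  rwa [← AlgHom.comp_apply, ← AlgHom.comp_apply, h3, AlgHom.id_apply, AlgHom.id_apply] at h2

/-- The action of `g ∈ GL_ℓ(ℝ)` on rational functions, `f ↦ f ∘ g⁻¹`. -/
def fAct (g : Matrix.GeneralLinearGroup (Fin ℓ) ℝ) : Ffield ℓ →+* Ffield ℓ :=
  IsFractionRing.lift (g :=
    (algebraMap (Spoly ℓ) (Ffield ℓ)).comp
      (matSub (↑g⁻¹ : Matrix (Fin ℓ) (Fin ℓ) ℝ)).toRingHom)
    ((IsFractionRing.injective (Spoly ℓ) (Ffield ℓ)).comp (matSub_injective g⁻¹))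

/-- The natural action of an **orthogonal** `g` on the component vector of a
differential 1-form (equivalently, of a derivation): `(g·v)_x = Σ_y g_{x y} · g(v_y)`. -/
def vecAct (g : Matrix.GeneralLinearGroup (Fin ℓ) ℝ) (v : OmF ℓ) : OmF ℓ :=
  fun x => ∑ y, cF ((↑g : Matrix (Fin ℓ) (Fin ℓ) ℝ) x y) * fAct g (v y)

/-- `W`-invariant component vectors (1-forms/derivations). -/
def InvVec (W : Subgroup (Matrix.GeneralLinearGroup (Fin ℓ) ℝ)) : Set (OmF ℓ) :=
  {ω | ∀ g ∈ W, vecAct g ω = ω}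

/-- `Ω(A,∞)^W`. -/
def OmegaInfW (A : Finset (Fin ℓ → ℝ)) (W : Subgroup (Matrix.GeneralLinearGroup (Fin ℓ) ℝ)) :
    Set (OmF ℓ) := OmegaInf A ∩ InvVec W

/-- `Ω(A,m)^W = Ω(A,m) ∩ Ω(A,∞)^W`. -/
def OmegaMultW (A : Finset (Fin ℓ → ℝ)) (W : Subgroup (Matrix.GeneralLinearGroup (Fin ℓ) ℝ))
    (m : (Fin ℓ → ℝ) → ℤ) : Set (OmF ℓ) := OmegaMult A m ∩ InvVec W

/-- `W`-invariant polynomials. -/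
def InvPoly (W : Subgroup (Matrix.GeneralLinearGroup (Fin ℓ) ℝ)) : Set (Spoly ℓ) :=
  {p | ∀ g ∈ W, matSub (↑g : Matrix (Fin ℓ) (Fin ℓ) ℝ) p = p}

/-- The invariant ring `R = S^W`, viewed inside `F`. -/
def RF (W : Subgroup (Matrix.GeneralLinearGroup (Fin ℓ) ℝ)) : Set (Ffield ℓ) :=
  toF '' InvPoly W

/-- The orthogonal reflection through the hyperplane `ker⟨a, ·⟩`. -/
def reflMat (a : Fin ℓ → ℝ) : Matrix (Fin ℓ) (Fin ℓ) ℝ :=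
  1 - (2 / ∑ x, a x * a x) • Matrix.vecMulVec a a

/-! ### Block (irreducible-factor) structure. -/

/-- A polynomial involving only the variables of the block `i` (w.r.t. the block
assignment `blk : Fin ℓ → Fin t`). -/
def blockPoly (blk : Fin ℓ → Fin t) (i : Fin t) (p : Spoly ℓ) : Prop :=
  ∀ m ∈ p.support, ∀ x ∈ Finsupp.support m, blk x = i

/-- Rational functions in the variables of block `i` only. -/
def blockFrac (blk : Fin ℓ → Fin t) (i : Fin t) : Set (Ffield ℓ) :=
  {y | ∃ p q : Spoly ℓ, blockPoly blk i p ∧ blockPoly blk i q ∧ q ≠ 0 ∧ y * toF q = toF p}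

/-- A component vector belonging to the factor `V[i]`:  components outside block `i`
vanish and all components are rational functions of the block-`i` variables. -/
def BlockVec (blk : Fin ℓ → Fin t) (i : Fin t) (ω : OmF ℓ) : Prop :=
  (∀ x, blk x ≠ i → ω x = 0) ∧ ∀ x, ω x ∈ blockFrac blk i

/-- All the data of a (not necessarily irreducible) Coxeter arrangement `A` in the
Euclidean space `V = ℝ^ℓ`, together with its decomposition into `t` irreducible
factors and a system of basic invariants:

* `A` is a finite set of hyperplanes, recorded by nonzero defining normal vectors,
  pairwise non-proportional;
* `W` is a finite subgroup of `GL_ℓ(ℝ)` consisting of orthogonal transformations,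
  generated by the reflections through the members of `A`, and `A` is exactly the
  set of reflecting hyperplanes of `W` (so `A` is the Coxeter arrangement of the
  finite real reflection group `W`);
* `blk` assigns to every coordinate its irreducible block `V[i]`, every hyperplane
  of `A` lies over a single block;
* `P c` (`c : Fin ℓ`) are basic invariants: homogeneous, `W`-invariant,
  algebraically independent generators of `R = S^W`, the invariants of the block `i`
  being those `P c` with `blk c = i` and involving only block-`i` variables;
* within each block `i` the invariant `P (top i)` has strictly largest degree
  (this uses irreducibility of the factors; it makes the primitive derivations
  `D[i] = ∂/∂P_{ℓ[i]}[i]` well defined up to constants). -/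
structure CoxeterSetup (ℓ t : ℕ) where
  A : Finset (Fin ℓ → ℝ)
  W : Subgroup (Matrix.GeneralLinearGroup (Fin ℓ) ℝ)
  hA0 : ∀ a ∈ A, a ≠ 0
  hAprop : ∀ a ∈ A, ∀ b ∈ A, (∃ c : ℝ, a = c • b) → a = b
  hWfin : (W : Set (Matrix.GeneralLinearGroup (Fin ℓ) ℝ)).Finite
  hWorth : ∀ g ∈ W, Matrix.transpose (↑g : Matrix (Fin ℓ) (Fin ℓ) ℝ) * (↑g : Matrix (Fin ℓ) (Fin ℓ) ℝ) = 1
  hrefl : ∀ a ∈ A, ∃ g ∈ W, (↑g : Matrix (Fin ℓ) (Fin ℓ) ℝ) = reflMat a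
  hhyp : ∀ g ∈ W, ∀ a : Fin ℓ → ℝ, a ≠ 0 → (↑g : Matrix (Fin ℓ) (Fin ℓ) ℝ) = reflMat a →
    ∃ b ∈ A, ∃ c : ℝ, a = c • b
  hgen : W = Subgroup.closure
    {g : Matrix.GeneralLinearGroup (Fin ℓ) ℝ | ∃ a ∈ A, (↑g : Matrix (Fin ℓ) (Fin ℓ) ℝ) = reflMat a}
  blk : Fin ℓ → Fin t
  hblkA : ∀ a ∈ A, ∃ i, ∀ x, a x ≠ 0 → blk x = i
  P : Fin ℓ → MvPolynomial (Fin ℓ) ℝ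
  deg : Fin ℓ → ℕ
  hdeg : ∀ c, 0 < deg c
  hPhom : ∀ c, (P c).IsHomogeneous (deg c)
  hPblock : ∀ c, blockPoly blk (blk c) (P c)
  hPinv : ∀ c, P c ∈ InvPoly W
  hPind : AlgebraicIndependent ℝ P
  hPgen : ∀ p : Spoly ℓ, p ∈ InvPoly W ↔ p ∈ Algebra.adjoin ℝ (Set.range P)
  top : Fin t → Fin ℓ
  htop : ∀ i, blk (top i) = i
  htopdeg : ∀ i c, blk c = i → c ≠ top i → deg c < deg (top i)

/-! ### Primitive derivations and the connection `∇_D`. -/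

/-- The covariant derivative `∇_D` on rational 1-forms: since `∇_D (dx_x) = 0`,
it acts componentwise, `∇_D(Σ f_x dx_x) = Σ D(f_x) dx_x`. -/
def nabVec (D : Derivation ℝ (Ffield ℓ) (Ffield ℓ)) (ω : OmF ℓ) : OmF ℓ :=
  fun x => D (ω x)

/-- `T = ker (D : R → R)`, viewed inside `F`. -/
def TF (W : Subgroup (Matrix.GeneralLinearGroup (Fin ℓ) ℝ))
    (D : Derivation ℝ (Ffield ℓ) (Ffield ℓ)) : Set (Ffield ℓ) :=
  {y ∈ RF W | D y = 0}

/-- The differential `dP` of a polynomial, as a component vector: `(dP)_x = ∂P/∂x_x`. -/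
def dPoly (p : Spoly ℓ) : OmF ℓ := fun x => toF (MvPolynomial.pderiv x p)

/-! ### Freeness of a submodule over a subring of coefficients. -/

/-- `v : ι → M` is a basis of the sub-`C`-module `Mod ⊆ M` over the coefficient
set `C ⊆ F`: the members of the family lie in `Mod`, every element of `Mod`
is a finite `C`-linear combination of them, and they are linearly independent
over `C`. -/
def IsBasisOver {ℓ : ℕ} {ι M : Type*} [AddCommMonoid M] [Module (Ffield ℓ) M]
    (C : Set (Ffield ℓ)) (Mod : Set M) (v : ι → M) : Prop :=
  (∀ j, v j ∈ Mod) ∧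
  (∀ ω ∈ Mod, ∃ c : ι →₀ Ffield ℓ, (∀ j, c j ∈ C) ∧ ω = c.sum fun j a => a • v j) ∧
  (∀ c : ι →₀ Ffield ℓ, (∀ j, c j ∈ C) → (c.sum fun j a => a • v j) = 0 → c = 0)

/-! ### Order of poles along a hyperplane. -/

/-- The localization `S_{(α)}` of `S` at the prime ideal `(α)`, viewed in `F`:
fractions with denominator prime to `α`. -/
def Sloc (a : Fin ℓ → ℝ) : Set (Ffield ℓ) :=
  {y | ∃ p q : Spoly ℓ, ¬ linForm a ∣ q ∧ y * toF q = toF p}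

/-- `ordEq a f k` says `ord_α(f) = k`, i.e. `k = min {j : α^j f ∈ S_{(α)}}`. -/
def ordEq (a : Fin ℓ → ℝ) (f : Ffield ℓ) (k : ℤ) : Prop :=
  linF a ^ k * f ∈ Sloc a ∧ ∀ j : ℤ, linF a ^ j * f ∈ Sloc a → k ≤ j

/-! ### Logarithmic derivation modules. -/

/-- The module `D(A,−∞)` of logarithmic derivations (Definition 4.1):
`Q^N ξ` regular and `(Q/α_H)^N ξ(β)` regular whenever `β ⊥ α_H`. -/
def DerInf (A : Finset (Fin ℓ → ℝ)) : Set (Derivation ℝ (Ffield ℓ) (Ffield ℓ)) :=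
  {ξ | ∃ N : ℕ,
    (∀ x, QF A ^ N * ξ (XF x) ∈ Sreg ℓ) ∧
    ∀ a ∈ A, ∀ b : Fin ℓ → ℝ, (∑ x, a x * b x) = 0 →
      (QF A / linF a) ^ N * ξ (linF b) ∈ Sreg ℓ}

/-- `D(A,m)` for a multiplicity `m : A → ℤ`:
`(Q/α_H)^N ξ(α_H) ∈ α_H^{m(H)} S` for `N ≫ 0`. -/
def DerMult (A : Finset (Fin ℓ → ℝ)) (m : (Fin ℓ → ℝ) → ℤ) :
    Set (Derivation ℝ (Ffield ℓ) (Ffield ℓ)) :=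
  {ξ ∈ DerInf A | ∃ N : ℕ, ∀ a ∈ A, ∃ p : Spoly ℓ,
    (QF A / linF a) ^ N * ξ (linF a) = linF a ^ m a * toF p}

/-- The component vector of a derivation: `ξ = Σ_x ξ(x_x) ∂_x`. -/
def derVec (ξ : Derivation ℝ (Ffield ℓ) (Ffield ℓ)) : OmF ℓ := fun x => ξ (XF x)

/-- `W`-invariant derivations (via the action on component vectors; the group
consists of orthogonal transformations). -/
def InvDer (W : Subgroup (Matrix.GeneralLinearGroup (Fin ℓ) ℝ)) :
    Set (Derivation ℝ (Ffield ℓ) (Ffield ℓ)) :=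
  {ξ | ∀ g ∈ W, vecAct g (derVec ξ) = derVec ξ}

/-- `D(A,−∞)^W`. -/
def DerInfW (A : Finset (Fin ℓ → ℝ)) (W : Subgroup (Matrix.GeneralLinearGroup (Fin ℓ) ℝ)) :
    Set (Derivation ℝ (Ffield ℓ) (Ffield ℓ)) := DerInf A ∩ InvDer W

/-- `D(A,m)^W = D(A,m) ∩ D(A,−∞)^W`. -/
def DerMultW (A : Finset (Fin ℓ → ℝ)) (W : Subgroup (Matrix.GeneralLinearGroup (Fin ℓ) ℝ))
    (m : (Fin ℓ → ℝ) → ℤ) : Set (Derivation ℝ (Ffield ℓ) (Ffield ℓ)) :=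
  DerMult A m ∩ InvDer W

/-- `I* : Ω_F → Der_F`, `I*(ω)(f) = I*(ω, df) = Σ_x ω_x ∂f/∂x_x`, defined using a
family `pd` of partial-derivative derivations of `F`. -/
def IstarDer (pd : Fin ℓ → Derivation ℝ (Ffield ℓ) (Ffield ℓ)) (ω : OmF ℓ) :
    Derivation ℝ (Ffield ℓ) (Ffield ℓ) :=
  ∑ x, ω x • pd x

/-- The covariant derivative `∇_D` on rational derivations: `(∇_D ξ)(α) = D(ξ(α))`
for `α ∈ V*`, i.e. `∇_D ξ = Σ_x D(ξ(x_x)) ∂_x`. -/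
def nabDer (pd : Fin ℓ → Derivation ℝ (Ffield ℓ) (Ffield ℓ))
    (D : Derivation ℝ (Ffield ℓ) (Ffield ℓ))
    (ξ : Derivation ℝ (Ffield ℓ) (Ffield ℓ)) : Derivation ℝ (Ffield ℓ) (Ffield ℓ) :=
  ∑ x, D (ξ (XF x)) • pd x

end CoxeterFormalization

section LocalRings

variable {ℓ : ℕ}

lemma toF_add (p q : Spoly ℓ) : toF (p + q) = toF p + toF q := map_add _ _ _
lemma toF_sub (p q : Spoly ℓ) : toF (p - q) = toF p - toF q := map_sub _ _ _
lemma toF_neg (p : Spoly ℓ) : toF (-p) = -toF p := map_neg _ _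
lemma toF_mul (p q : Spoly ℓ) : toF (p * q) = toF p * toF q := map_mul _ _ _
lemma toF_pow (p : Spoly ℓ) (n : ℕ) : toF (p ^ n) = toF p ^ n := map_pow _ _ _
lemma toF_zero : toF (0 : Spoly ℓ) = 0 := map_zero _
lemma toF_one : toF (1 : Spoly ℓ) = 1 := map_one _
lemma toF_sum {ι : Type*} (s : Finset ι) (f : ι → Spoly ℓ) :
    toF (∑ i ∈ s, f i) = ∑ i ∈ s, toF (f i) := map_sum _ _ _

lemma toF_injective : Function.Injective (toF : Spoly ℓ → Ffield ℓ) :=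
  IsFractionRing.injective (Spoly ℓ) (Ffield ℓ)

lemma toF_ne_zero {p : Spoly ℓ} (h : p ≠ 0) : toF p ≠ 0 := fun h0 =>
  h (toF_injective (h0.trans toF_zero.symm))

lemma toF_C (r : ℝ) : toF (C r : Spoly ℓ) = algebraMap ℝ (Ffield ℓ) r :=
  (IsScalarTower.algebraMap_apply ℝ (Spoly ℓ) (Ffield ℓ) r).symm

lemma cF_eq (r : ℝ) : (cF r : Ffield ℓ) = algebraMap ℝ (Ffield ℓ) r := toF_C r

lemma linF_eq (a : Fin ℓ → ℝ) : linF a = ∑ x, cF (a x) * XF x := by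
  simp only [linF, linForm, toF_sum, toF_mul, cF, XF]

lemma coeff_linForm (a : Fin ℓ → ℝ) (x : Fin ℓ) :
    coeff (Finsupp.single x 1) (linForm a) = a x := by
  classical
  simp only [linForm, coeff_sum, coeff_C_mul, coeff_X, Finsupp.single_left_inj one_ne_zero]
  simp

lemma linForm_add (a b : Fin ℓ → ℝ) : linForm (a + b) = linForm a + linForm b := by
  simp [linForm, add_mul, Finset.sum_add_distrib]

lemma linForm_smul (c : ℝ) (a : Fin ℓ → ℝ) : linForm (c • a) = C c * linForm a := by
  simp [linForm, Finset.mul_sum, mul_assoc]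

lemma linForm_single (x : Fin ℓ) : linForm (Pi.single x 1) = X x := by
  classical
  simp only [linForm, Pi.single_apply]
  simp [apply_ite C]

lemma linForm_isHomogeneous (a : Fin ℓ → ℝ) : (linForm a).IsHomogeneous 1 := by
  refine IsHomogeneous.sum _ _ _ fun x _ => ?_
  simpa using (isHomogeneous_C _ (a x)).mul (isHomogeneous_X ℝ x)

lemma linForm_ne_zero {a : Fin ℓ → ℝ} (ha : a ≠ 0) : linForm a ≠ 0 := by
  obtain ⟨x, hx⟩ := Function.ne_iff.1 ha
  intro h
  exact hx (by simpa [h] using (coeff_linForm a x).symm)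

lemma linF_ne_zero {a : Fin ℓ → ℝ} (ha : a ≠ 0) : linF a ≠ 0 := toF_ne_zero (linForm_ne_zero ha)

lemma linForm_prime {a : Fin ℓ → ℝ} (ha : a ≠ 0) : Prime (linForm a) := by
  rw [← irreducible_iff_prime]
  obtain ⟨x, hx⟩ := Function.ne_iff.1 ha
  refine irreducible_of_totalDegree_eq_one
    ((linForm_isHomogeneous a).totalDegree (linForm_ne_zero ha)) fun r hr => ?_
  refine isUnit_iff_ne_zero.2 fun h0 => hx ?_
  have := hr (Finsupp.single x 1)
  rw [h0, zero_dvd_iff, coeff_linForm] at this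
  simpa using this

lemma exists_smul_of_linForm_dvd {a b : Fin ℓ → ℝ} (ha : a ≠ 0) (hb : b ≠ 0)
    (h : linForm a ∣ linForm b) : ∃ c : ℝ, b = c • a := by
  obtain ⟨q, hq⟩ := h
  have hb0 := linForm_ne_zero hb
  have hq0 : q ≠ 0 := by rintro rfl; simp [hq] at hb0
  have hdeg : q.totalDegree = 0 := by
    have h1 := totalDegree_mul_of_isDomain (linForm_ne_zero ha) hq0
    rw [← hq, (linForm_isHomogeneous b).totalDegree hb0,
      (linForm_isHomogeneous a).totalDegree (linForm_ne_zero ha)] at h1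
    omega
  rw [totalDegree_eq_zero_iff_eq_C] at hdeg
  refine ⟨coeff 0 q, funext fun x => ?_⟩
  rw [← coeff_linForm b x, hq, hdeg, mul_comm, coeff_C_mul, coeff_linForm]
  simp

/-- The local ring `S_{(α)}` as a subring of `F`. -/
def slocRing (a : Fin ℓ → ℝ) (ha : a ≠ 0) : Subring (Ffield ℓ) where
  carrier := Sloc a
  mul_mem' := by
    rintro x y ⟨p, q, hq, h⟩ ⟨p', q', hq', h'⟩
    refine ⟨p * p', q * q', fun hd => ((linForm_prime ha).dvd_or_dvd hd).elim hq hq', ?_⟩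
    rw [toF_mul, toF_mul, ← h, ← h']; ring
  one_mem' := ⟨1, 1, fun h => (linForm_prime ha).not_isUnit (isUnit_of_dvd_one h), by simp⟩
  add_mem' := by
    rintro x y ⟨p, q, hq, h⟩ ⟨p', q', hq', h'⟩
    refine ⟨p * q' + p' * q, q * q',
      fun hd => ((linForm_prime ha).dvd_or_dvd hd).elim hq hq', ?_⟩
    rw [toF_mul, toF_add, toF_mul, toF_mul, ← h, ← h']; ring
  zero_mem' := ⟨0, 1, fun h => (linForm_prime ha).not_isUnit (isUnit_of_dvd_one h),
    by simp [toF_zero]⟩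
  neg_mem' := by
    rintro x ⟨p, q, hq, h⟩
    exact ⟨-p, q, hq, by rw [toF_neg, ← h]; ring⟩

variable {a : Fin ℓ → ℝ} {ha : a ≠ 0}

lemma toF_mem (p : Spoly ℓ) : toF p ∈ slocRing a ha :=
  ⟨p, 1, fun h => (linForm_prime ha).not_isUnit (isUnit_of_dvd_one h), by simp [toF_one]⟩

lemma Sreg_subset {y : Ffield ℓ} (h : y ∈ Sreg ℓ) : y ∈ slocRing a ha := by
  obtain ⟨p, rfl⟩ := h
  exact toF_mem p

lemma algebraMap_mem_sloc (r : ℝ) : algebraMap ℝ (Ffield ℓ) r ∈ slocRing a ha := by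
  rw [← toF_C]; exact toF_mem _

lemma inv_toF_mem {q : Spoly ℓ} (hq : ¬ linForm a ∣ q) : (toF q)⁻¹ ∈ slocRing a ha := by
  refine ⟨1, q, hq, ?_⟩
  rw [toF_one, inv_mul_cancel₀ (toF_ne_zero _)]
  rintro rfl; exact hq (dvd_zero _)

/-- If `α c` is in `S_{(α)}` but `c` is not, then `α c` is a unit of `S_{(α)}`. -/
lemma mem_sloc_of_mul_mem {c z : Ffield ℓ} (hc : linF a * c ∈ slocRing a ha)
    (hc' : c ∉ slocRing a ha) (hz : linF a * c * z ∈ slocRing a ha) : z ∈ slocRing a ha := by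
  obtain ⟨p, q, hq, h⟩ := hc
  have hp : ¬ linForm a ∣ p := by
    rintro ⟨r, rfl⟩
    refine hc' ⟨r, q, hq, ?_⟩
    apply mul_left_cancel₀ (linF_ne_zero ha)
    rw [← mul_assoc, h, toF_mul, linF]
  have hq0 : toF q ≠ 0 := toF_ne_zero (by rintro rfl; exact hq (dvd_zero _))
  have hp0 : toF p ≠ 0 := toF_ne_zero (by rintro rfl; exact hp (dvd_zero _))
  have : z = linF a * c * z * (toF p)⁻¹ * toF q := by
    field_simp
    rw [← h]; ring
  rw [this]
  exact Subring.mul_mem _ (Subring.mul_mem _ hz (inv_toF_mem hp)) (toF_mem q)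

lemma dvd_iff_sloc {p : Spoly ℓ} : linForm a ∣ p ↔ (linF a)⁻¹ * toF p ∈ slocRing a ha := by
  have h0 := linF_ne_zero ha
  constructor
  · rintro ⟨r, rfl⟩
    rw [toF_mul, ← linF, inv_mul_cancel_left₀ h0]
    exact toF_mem r
  · rintro ⟨p', q, hq, h⟩
    have : p * q = linForm a * p' := by
      apply toF_injective
      rw [toF_mul, toF_mul, ← h, ← linF]; field_simp
    exact ((linForm_prime ha).dvd_or_dvd ⟨p', this⟩).resolve_right hq

/-- A rational function whose poles lie on `A` and which is regular at every member of `A`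
is a polynomial. -/
lemma mem_Sreg_of_local {A : Finset (Fin ℓ → ℝ)} (hA : ∀ a ∈ A, a ≠ 0) {y : Ffield ℓ} {N : ℕ}
    (hN : QF A ^ N * y ∈ Sreg ℓ) (hloc : ∀ a (h : a ∈ A), y ∈ slocRing a (hA a h)) :
    y ∈ Sreg ℓ := by
  obtain ⟨p, q, hrel, hy⟩ := IsFractionRing.exists_reduced_fraction (A := Spoly ℓ) y
  have hq0 : toF (q : Spoly ℓ) ≠ 0 := toF_ne_zero (nonZeroDivisors.ne_zero q.2)
  have hy' : y * toF (q : Spoly ℓ) = toF p := by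
    rw [← hy, toF, toF]
    exact IsLocalization.mk'_spec _ _ _
  have hdvd : (q : Spoly ℓ) ∣ (∏ b ∈ A, linForm b) ^ N := by
    obtain ⟨r, hr⟩ := hN
    refine hrel.symm.dvd_of_dvd_mul_right ⟨r, toF_injective ?_⟩
    rw [toF_mul, toF_mul, ← hy', toF_pow]
    change _ = _ * (algebraMap _ _ r)
    rw [hr, QF]; ring
  have hunit : IsUnit (q : Spoly ℓ) := by
    by_contra hu
    obtain ⟨π, hπ, hπq⟩ := WfDvdMonoid.exists_irreducible_factor hu (nonZeroDivisors.ne_zero q.2)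
    have hπp := irreducible_iff_prime.1 hπ
    obtain ⟨b, hb, hd⟩ := (hπp.dvd_finsetProd_iff _).1 (hπp.dvd_of_dvd_pow (hπq.trans hdvd))
    have hbq : linForm b ∣ (q : Spoly ℓ) :=
      ((hπp.associated_of_dvd (linForm_prime (hA b hb)) hd).symm.dvd).trans hπq
    obtain ⟨p', q', hq', h⟩ := hloc b hb
    have hpq : p * q' = p' * q := by
      apply toF_injective
      rw [toF_mul, toF_mul, ← h, ← hy']; ring
    have hbp : linForm b ∣ p :=
      ((linForm_prime (hA b hb)).dvd_or_dvd (hpq ▸ hbq.mul_left p')).resolve_right hq'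
    exact (linForm_prime (hA b hb)).not_isUnit (hrel hbp hbq)
  obtain ⟨u, hu⟩ := hunit
  refine ⟨p * ↑u⁻¹, ?_⟩
  change toF _ = _
  rw [toF_mul, ← hy', ← hu, mul_assoc, ← toF_mul]
  simp [toF_one]

end LocalRings

section Reflections

variable {ℓ : ℕ}

lemma matSub_linForm (M : Matrix (Fin ℓ) (Fin ℓ) ℝ) (b : Fin ℓ → ℝ) :
    matSub M (linForm b) = linForm (Matrix.vecMul b M) := by
  simp only [linForm, matSub, map_sum, map_mul, aeval_X, algHom_C, algebraMap_eq,
    Matrix.vecMul, dotProduct, Finset.mul_sum, Finset.sum_mul, mul_assoc]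
  exact Finset.sum_comm

lemma vecMul_reflMat (a b : Fin ℓ → ℝ) :
    Matrix.vecMul b (reflMat a) = b - (2 / (∑ x, a x * a x) * ∑ x, a x * b x) • a := by
  ext y
  simp only [Matrix.vecMul, reflMat, dotProduct, Matrix.sub_apply, Matrix.smul_apply,
    Matrix.vecMulVec_apply, smul_eq_mul, mul_sub, Finset.sum_sub_distrib, Pi.sub_apply,
    Pi.smul_apply, Matrix.one_apply, Finset.mul_sum, Finset.sum_mul]
  congr 1
  · simp
  · exact Finset.sum_congr rfl fun x _ => by ring

lemma sum_sq_ne_zero {a : Fin ℓ → ℝ} (ha : a ≠ 0) : ∑ x, a x * a x ≠ 0 := fun h =>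
  ha (dotProduct_self_eq_zero.1 h)

lemma vecMul_reflMat_self {a : Fin ℓ → ℝ} (ha : a ≠ 0) : Matrix.vecMul a (reflMat a) = -a := by
  rw [vecMul_reflMat, div_mul_cancel₀ _ (sum_sq_ne_zero ha), two_smul]; abel

lemma vecMul_reflMat_of_orthogonal {a b : Fin ℓ → ℝ} (h : ∑ x, a x * b x = 0) :
    Matrix.vecMul b (reflMat a) = b := by
  rw [vecMul_reflMat, h]; simp

lemma reflMat_transpose (a : Fin ℓ → ℝ) : (reflMat a).transpose = reflMat a := by
  ext x y
  simp [reflMat, Matrix.vecMulVec_apply, Matrix.one_apply, eq_comm, mul_comm]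

lemma reflMat_mul_self {a : Fin ℓ → ℝ} (ha : a ≠ 0) : reflMat a * reflMat a = 1 := by
  refine Matrix.ext_of_single_vecMul fun i => ?_
  rw [← Matrix.vecMul_vecMul, vecMul_reflMat a (Pi.single i 1), Matrix.sub_vecMul,
    Matrix.smul_vecMul, vecMul_reflMat_self ha, vecMul_reflMat]
  simp

/-- The component of the `x`-th coordinate vector orthogonal to `a`. -/
noncomputable def orthPart (a : Fin ℓ → ℝ) (x : Fin ℓ) : Fin ℓ → ℝ :=
  Pi.single x 1 - (a x / ∑ y, a y * a y) • a

lemma orthPart_orthogonal {a : Fin ℓ → ℝ} (ha : a ≠ 0) (x : Fin ℓ) :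
    ∑ y, a y * orthPart a x y = 0 := by
  have h := sum_sq_ne_zero ha
  have h1 : ∑ y, a y * orthPart a x y
      = a x - (a x / ∑ y, a y * a y) * ∑ y, a y * a y := by
    simp only [orthPart, Pi.sub_apply, Pi.smul_apply, smul_eq_mul, mul_sub,
      Finset.sum_sub_distrib, Finset.mul_sum, Pi.single_apply]
    congr 1
    · simp
    · exact Finset.sum_congr rfl fun y _ => by ring
  rw [h1, div_mul_cancel₀ _ h, sub_self]

lemma X_eq_orthPart (a : Fin ℓ → ℝ) (x : Fin ℓ) :
    (X x : Spoly ℓ) = linForm (orthPart a x) + C (a x / ∑ y, a y * a y) * linForm a := by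
  rw [← linForm_smul, ← linForm_add, orthPart, sub_add_cancel, linForm_single]

/-- Polynomials in `α²` and in the linear forms orthogonal to `α`. -/
noncomputable def evenAlg (a : Fin ℓ → ℝ) : Subalgebra ℝ (Spoly ℓ) :=
  Algebra.adjoin ℝ (insert (linForm a ^ 2) (linForm '' {b | ∑ x, a x * b x = 0}))

lemma sq_mem_evenAlg (a : Fin ℓ → ℝ) : linForm a ^ 2 ∈ evenAlg a :=
  Algebra.subset_adjoin (Set.mem_insert _ _)

lemma linForm_mem_evenAlg {a b : Fin ℓ → ℝ} (h : ∑ x, a x * b x = 0) :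
    linForm b ∈ evenAlg a :=
  Algebra.subset_adjoin (Set.mem_insert_of_mem _ ⟨b, h, rfl⟩)

lemma exists_even_odd {a : Fin ℓ → ℝ} (ha : a ≠ 0) (p : Spoly ℓ) :
    ∃ p₀ ∈ evenAlg a, ∃ p₁ ∈ evenAlg a, p = p₀ + linForm a * p₁ := by
  induction p using MvPolynomial.induction_on with
  | C r => exact ⟨C r, (evenAlg a).algebraMap_mem r, 0, zero_mem _, by simp⟩
  | add p q hp hq =>
    obtain ⟨p₀, h0, p₁, h1, rfl⟩ := hp
    obtain ⟨q₀, k0, q₁, k1, rfl⟩ := hq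
    exact ⟨p₀ + q₀, add_mem h0 k0, p₁ + q₁, add_mem h1 k1, by ring⟩
  | mul_X p x hp =>
    obtain ⟨p₀, h0, p₁, h1, rfl⟩ := hp
    have hb := linForm_mem_evenAlg (orthPart_orthogonal ha x)
    have hc : C (a x / ∑ y, a y * a y) ∈ evenAlg a := (evenAlg a).algebraMap_mem _
    refine ⟨p₀ * linForm (orthPart a x) + linForm a ^ 2 * (p₁ * C (a x / ∑ y, a y * a y)),
      add_mem (mul_mem h0 hb) (mul_mem (sq_mem_evenAlg a) (mul_mem h1 hc)),
      p₀ * C (a x / ∑ y, a y * a y) + p₁ * linForm (orthPart a x),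
      add_mem (mul_mem h0 hc) (mul_mem h1 hb), ?_⟩
    nth_rewrite 1 [X_eq_orthPart a x]
    ring

lemma matSub_reflMat_self {a : Fin ℓ → ℝ} (ha : a ≠ 0) :
    matSub (reflMat a) (linForm a) = -linForm a := by
  rw [matSub_linForm, vecMul_reflMat_self ha, ← neg_one_smul ℝ a, linForm_smul]; simp

lemma matSub_reflMat_of_mem_evenAlg {a : Fin ℓ → ℝ} (ha : a ≠ 0) {p : Spoly ℓ}
    (hp : p ∈ evenAlg a) : matSub (reflMat a) p = p := by
  have : evenAlg a ≤ AlgHom.equalizer (matSub (reflMat a)) (AlgHom.id ℝ (Spoly ℓ)) := by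
    refine Algebra.adjoin_le ?_
    rintro _ (rfl | ⟨b, hb, rfl⟩)
    · simp [matSub_reflMat_self ha]
    · simp [matSub_linForm, vecMul_reflMat_of_orthogonal hb]
  exact this hp

lemma matSub_reflMat_even_odd {a : Fin ℓ → ℝ} (ha : a ≠ 0) {p₀ p₁ : Spoly ℓ}
    (h0 : p₀ ∈ evenAlg a) (h1 : p₁ ∈ evenAlg a) :
    matSub (reflMat a) (p₀ + linForm a * p₁) = p₀ - linForm a * p₁ := by
  rw [map_add, map_mul, matSub_reflMat_self ha, matSub_reflMat_of_mem_evenAlg ha h0,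
    matSub_reflMat_of_mem_evenAlg ha h1]
  ring

lemma mem_evenAlg_of_invariant {a : Fin ℓ → ℝ} (ha : a ≠ 0) {p : Spoly ℓ}
    (hp : matSub (reflMat a) p = p) : p ∈ evenAlg a := by
  obtain ⟨p₀, h0, p₁, h1, rfl⟩ := exists_even_odd ha p
  rw [matSub_reflMat_even_odd ha h0 h1] at hp
  have : linForm a * p₁ = 0 := by
    have h2 : (2 : Spoly ℓ) * (linForm a * p₁) = 0 := by linear_combination -hp
    exact (mul_eq_zero.1 h2).resolve_left two_ne_zero
  rwa [this, add_zero]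

lemma linForm_dvd_matSub_sub {a : Fin ℓ → ℝ} (ha : a ≠ 0) (p : Spoly ℓ) :
    linForm a ∣ matSub (reflMat a) p - p := by
  obtain ⟨p₀, h0, p₁, h1, rfl⟩ := exists_even_odd ha p
  rw [matSub_reflMat_even_odd ha h0 h1]
  exact ⟨-2 * p₁, by ring⟩

/-! ### The action on rational functions. -/

lemma fAct_toF (g : Matrix.GeneralLinearGroup (Fin ℓ) ℝ) (p : Spoly ℓ) :
    fAct g (toF p) = toF (matSub (↑g⁻¹ : Matrix (Fin ℓ) (Fin ℓ) ℝ) p) :=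
  IsFractionRing.lift_algebraMap _ _

lemma fAct_algebraMap (g : Matrix.GeneralLinearGroup (Fin ℓ) ℝ) (r : ℝ) :
    fAct g (algebraMap ℝ (Ffield ℓ) r) = algebraMap ℝ (Ffield ℓ) r := by
  rw [← toF_C, fAct_toF]
  simp [matSub]

lemma coe_inv_of_orthogonal {g : Matrix.GeneralLinearGroup (Fin ℓ) ℝ}
    (hg : Matrix.transpose (↑g : Matrix (Fin ℓ) (Fin ℓ) ℝ) *
      (↑g : Matrix (Fin ℓ) (Fin ℓ) ℝ) = 1) :
    (↑g⁻¹ : Matrix (Fin ℓ) (Fin ℓ) ℝ) = (↑g : Matrix (Fin ℓ) (Fin ℓ) ℝ).transpose := by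
  rw [Matrix.coe_units_inv]
  exact Matrix.inv_eq_left_inv hg

lemma fAct_linF {g : Matrix.GeneralLinearGroup (Fin ℓ) ℝ}
    (hg : Matrix.transpose (↑g : Matrix (Fin ℓ) (Fin ℓ) ℝ) *
      (↑g : Matrix (Fin ℓ) (Fin ℓ) ℝ) = 1) (b : Fin ℓ → ℝ) :
    fAct g (linF b) = linF (Matrix.mulVec (↑g : Matrix (Fin ℓ) (Fin ℓ) ℝ) b) := by
  rw [linF, fAct_toF, matSub_linForm, coe_inv_of_orthogonal hg, Matrix.vecMul_transpose, linF]

lemma coe_inv_of_refl {a : Fin ℓ → ℝ} (ha : a ≠ 0) {g : Matrix.GeneralLinearGroup (Fin ℓ) ℝ}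
    (hg : (↑g : Matrix (Fin ℓ) (Fin ℓ) ℝ) = reflMat a) :
    (↑g⁻¹ : Matrix (Fin ℓ) (Fin ℓ) ℝ) = reflMat a := by
  rw [Matrix.coe_units_inv, hg]
  exact Matrix.inv_eq_left_inv (reflMat_mul_self ha)

variable {a : Fin ℓ → ℝ} {ha : a ≠ 0} {g : Matrix.GeneralLinearGroup (Fin ℓ) ℝ}

lemma fAct_refl_linF (ha : a ≠ 0) (hg : (↑g : Matrix (Fin ℓ) (Fin ℓ) ℝ) = reflMat a) :
    fAct g (linF a) = -linF a := by
  rw [linF, fAct_toF, coe_inv_of_refl ha hg, matSub_reflMat_self ha, toF_neg]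

/-- A regular anti-invariant function vanishes on the reflecting hyperplane. -/
lemma inv_mul_mem_of_anti (hg : (↑g : Matrix (Fin ℓ) (Fin ℓ) ℝ) = reflMat a) {u : Ffield ℓ}
    (hu : u ∈ slocRing a ha) (hanti : fAct g u = -u) : (linF a)⁻¹ * u ∈ slocRing a ha := by
  obtain ⟨p, q, hq, h⟩ := hu
  have hs : -u * toF (matSub (reflMat a) q) = toF (matSub (reflMat a) p) := by
    have := congrArg (fAct g) h
    rwa [map_mul, hanti, fAct_toF, fAct_toF, coe_inv_of_refl ha hg] at this
  obtain ⟨r, hr⟩ := linForm_dvd_matSub_sub ha p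
  obtain ⟨r', hr'⟩ := linForm_dvd_matSub_sub ha q
  have hp : toF (matSub (reflMat a) p) = toF p + linF a * toF r := by
    rw [linF, ← toF_mul, ← hr, toF_sub]; ring
  have hq' : toF (matSub (reflMat a) q) = toF q + linF a * toF r' := by
    rw [linF, ← toF_mul, ← hr', toF_sub]; ring
  have hα := linF_ne_zero ha
  have hp2 : 2 * toF p = - linF a * (toF r + u * toF r') := by
    rw [hp, hq'] at hs
    linear_combination -hs - h
  have hdvd : linForm a ∣ p := by
    rw [dvd_iff_sloc (ha := ha)]
    have : (linF a)⁻¹ * toF p = algebraMap ℝ _ (-1 / 2) * (toF r + u * toF r') := by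
      have h2 : (algebraMap ℝ (Ffield ℓ)) (-1 / 2) = -1 / 2 := by
        rw [map_div₀, map_neg, map_one, map_ofNat]
      rw [h2]; field_simp
      linear_combination hp2
    rw [this]
    exact Subring.mul_mem _ (algebraMap_mem_sloc _)
      (Subring.add_mem _ (toF_mem r) (Subring.mul_mem _ ⟨p, q, hq, h⟩ (toF_mem r')))
  obtain ⟨p', rfl⟩ := hdvd
  refine ⟨p', q, hq, ?_⟩
  rw [mul_assoc, h, toF_mul, ← linF, inv_mul_cancel_left₀ hα]

/-- An invariant element of `S_{(α)}` is a quotient of invariant polynomials. -/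
lemma exists_even_quotient (hg : (↑g : Matrix (Fin ℓ) (Fin ℓ) ℝ) = reflMat a) {u : Ffield ℓ}
    (hu : u ∈ slocRing a ha) (hinv : fAct g u = u) :
    ∃ p ∈ evenAlg a, ∃ q ∈ evenAlg a, ¬ linForm a ∣ q ∧ u * toF q = toF p := by
  obtain ⟨p, q, hq, h⟩ := hu
  have hss : ∀ r : Spoly ℓ, matSub (reflMat a) (matSub (reflMat a) r) = r := fun r => by
    rw [← AlgHom.comp_apply, matSub_comp, reflMat_mul_self ha, matSub_one, AlgHom.id_apply]
  have hNq : q * matSub (reflMat a) q ∈ evenAlg a :=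
    mem_evenAlg_of_invariant ha (by rw [map_mul, hss, mul_comm])
  have heq : u * toF (q * matSub (reflMat a) q) = toF (p * matSub (reflMat a) q) := by
    rw [toF_mul, ← mul_assoc, h, toF_mul]
  refine ⟨p * matSub (reflMat a) q, mem_evenAlg_of_invariant ha ?_, _, hNq, ?_, heq⟩
  · apply toF_injective
    have h1 := congrArg (fAct g) heq
    rw [map_mul, hinv, fAct_toF, fAct_toF, coe_inv_of_refl ha hg,
      matSub_reflMat_of_mem_evenAlg ha hNq] at h1
    rw [← h1, heq]
  · intro hd
    rcases (linForm_prime ha).dvd_or_dvd hd with hd | hd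
    · exact hq hd
    · exact hq (by simpa using dvd_sub hd (linForm_dvd_matSub_sub ha q))

end Reflections

section LocalDerivations

variable {ℓ : ℕ}

lemma der_linF (ξ : Derivation ℝ (Ffield ℓ) (Ffield ℓ)) (b : Fin ℓ → ℝ) :
    ξ (linF b) = ∑ x, cF (b x) * ξ (XF x) := by
  rw [linF_eq, map_sum]
  refine Finset.sum_congr rfl fun x _ => ?_
  rw [cF_eq, Derivation.leibniz, Derivation.map_algebraMap]
  simp

/-- A derivation of `F` killing algebraically independent polynomials `P₁, …, P_ℓ` vanishes. -/
lemma der_eq_zero_of_algebraicIndependent {P : Fin ℓ → Spoly ℓ}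
    (hP : AlgebraicIndependent ℝ P) (δ : Derivation ℝ (Ffield ℓ) (Ffield ℓ))
    (hδ : ∀ c, δ (toF (P c)) = 0) : δ = 0 := by
  have htr : IsTranscendenceBasis ℝ P :=
    hP.isTranscendenceBasis_of_lift_trdeg_le_of_finite (by
      rw [MvPolynomial.trdeg_of_isDomain]; simp)
  let K : IntermediateField ℝ (Ffield ℓ) :=
    { carrier := {y | δ y = 0}
      mul_mem' := fun {x y} hx hy => by
        simp only [Set.mem_ofPred_eq] at *
        rw [Derivation.leibniz, hx, hy]; simp
      add_mem' := fun {x y} hx hy => by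
        simp only [Set.mem_ofPred_eq] at *
        rw [map_add, hx, hy, add_zero]
      algebraMap_mem' := fun r => δ.map_algebraMap r
      inv_mem' := fun x hx => by
        simp only [Set.mem_ofPred_eq] at *
        rw [Derivation.leibniz_inv, hx]; simp }
  have hK : ∀ y, y ∈ K ↔ δ y = 0 := fun y => Iff.rfl
  have hsub : ∀ p ∈ Algebra.adjoin ℝ (Set.range P), toF p ∈ K := by
    intro p hp
    induction hp using Algebra.adjoin_induction with
    | mem x hx => obtain ⟨c, rfl⟩ := hx; exact hδ c
    | algebraMap r =>
      rw [algebraMap_eq, toF_C]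
      exact K.algebraMap_mem r
    | add x y _ _ h h' => rw [toF_add]; exact add_mem h h'
    | mul x y _ _ h h' => rw [toF_mul]; exact mul_mem h h'
  let δK : Derivation K (Ffield ℓ) (Ffield ℓ) :=
    { toFun := δ
      map_add' := map_add δ
      map_smul' := fun k y => by
        have hk : δ (k : Ffield ℓ) = 0 := k.2
        simp [Algebra.smul_def, IntermediateField.algebraMap_apply, Derivation.leibniz, hk]
      map_one_eq_zero' := δ.map_one_eq_zero
      leibniz' := δ.leibniz }
  have hpoly : ∀ p : Spoly ℓ, toF p ∈ K := by
    intro p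
    have halg : IsAlgebraic K (toF p) := by
      obtain ⟨f, hf0, hf⟩ := htr.isAlgebraic.isAlgebraic p
      let φ : Algebra.adjoin ℝ (Set.range P) →+* K :=
        { toFun := fun q => ⟨toF q, hsub q q.2⟩
          map_one' := Subtype.ext toF_one
          map_zero' := Subtype.ext toF_zero
          map_mul' := fun _ _ => Subtype.ext (toF_mul _ _)
          map_add' := fun _ _ => Subtype.ext (toF_add _ _) }
      have hφ : Function.Injective φ := fun q r h =>
        Subtype.ext (toF_injective (congrArg Subtype.val h))
      refine ⟨f.map φ, (Polynomial.map_ne_zero_iff hφ).2 hf0, ?_⟩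
      rw [Polynomial.aeval_def, Polynomial.eval₂_map]
      have h1 : (algebraMap K (Ffield ℓ)).comp φ
          = (algebraMap (Spoly ℓ) (Ffield ℓ)).comp
            (algebraMap (Algebra.adjoin ℝ (Set.range P)) (Spoly ℓ)) := rfl
      rw [h1]
      change Polynomial.eval₂ _ (algebraMap (Spoly ℓ) (Ffield ℓ) p) f = 0
      rw [← Polynomial.hom_eval₂, ← Polynomial.aeval_def, hf, map_zero]
    have hsep : (minpoly K (toF p)).Separable := (minpoly.irreducible halg.isIntegral).separable
    have h := δK.map_aeval (minpoly K (toF p)) (toF p)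
    rw [minpoly.aeval, map_zero, smul_eq_mul] at h
    exact (mul_eq_zero.1 h.symm).resolve_left
      (hsep.aeval_derivative_ne_zero (minpoly.aeval _ _))
  ext y
  obtain ⟨p, q, _, rfl⟩ := IsFractionRing.div_surjective (A := Spoly ℓ) y
  exact div_mem (hpoly p) (hpoly q)

lemma der_ext_X {ξ η : Derivation ℝ (Ffield ℓ) (Ffield ℓ)} (h : ∀ x, ξ (XF x) = η (XF x)) :
    ξ = η := by
  rw [← sub_eq_zero]
  refine der_eq_zero_of_algebraicIndependent (P := X) (algebraicIndependent_X (Fin ℓ) ℝ) _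
    fun c => ?_
  exact sub_eq_zero.2 (h c)

/-- The derivation has at most a simple pole along `α`, and no pole in directions along the
hyperplane. -/
structure SimplePoleAt (a : Fin ℓ → ℝ) (ha : a ≠ 0)
    (δ : Derivation ℝ (Ffield ℓ) (Ffield ℓ)) : Prop where
  tangential : ∀ b : Fin ℓ → ℝ, ∑ x, a x * b x = 0 → δ (linF b) ∈ slocRing a ha
  normal : linF a * δ (linF a) ∈ slocRing a ha

variable {a : Fin ℓ → ℝ} {ha : a ≠ 0} {g : Matrix.GeneralLinearGroup (Fin ℓ) ℝ}
  {δ : Derivation ℝ (Ffield ℓ) (Ffield ℓ)}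

lemma SimplePoleAt.map_even (hδ : SimplePoleAt a ha δ) {p : Spoly ℓ} (hp : p ∈ evenAlg a) :
    δ (toF p) ∈ slocRing a ha := by
  induction hp using Algebra.adjoin_induction with
  | mem x hx =>
    obtain rfl | ⟨b, hb, rfl⟩ := hx
    · rw [toF_pow, ← linF, sq, Derivation.leibniz, smul_eq_mul]
      exact add_mem hδ.normal hδ.normal
    · exact hδ.tangential b hb
  | algebraMap r =>
    rw [algebraMap_eq, toF_C, Derivation.map_algebraMap]
    exact zero_mem _
  | add x y _ _ h h' => rw [toF_add, map_add]; exact add_mem h h'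
  | mul x y _ _ h h' =>
    rw [toF_mul, Derivation.leibniz]
    exact add_mem (mul_mem (toF_mem _) h') (mul_mem (toF_mem _) h)

/-- A derivation with at most a simple normal pole preserves regularity of invariants. -/
lemma SimplePoleAt.map_invariant (hδ : SimplePoleAt a ha δ)
    (hg : (↑g : Matrix (Fin ℓ) (Fin ℓ) ℝ) = reflMat a) {u : Ffield ℓ}
    (hu : u ∈ slocRing a ha) (hinv : fAct g u = u) : δ u ∈ slocRing a ha := by
  obtain ⟨p, hp, q, hq, hd, h⟩ := exists_even_quotient hg hu hinv
  have hq0 : toF q ≠ 0 := toF_ne_zero (by rintro rfl; exact hd (dvd_zero _))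
  have h1 := congrArg δ h
  rw [Derivation.leibniz, smul_eq_mul, smul_eq_mul] at h1
  have : δ u = (toF q)⁻¹ * (δ (toF p) - u * δ (toF q)) := by
    rw [← h1]; field_simp; ring
  rw [this]
  exact mul_mem (inv_toF_mem hd)
    (sub_mem (hδ.map_even hp) (mul_mem hu (hδ.map_even hq)))

lemma fAct_zpow_mul (ha : a ≠ 0) (hg : (↑g : Matrix (Fin ℓ) (Fin ℓ) ℝ) = reflMat a)
    {f : Ffield ℓ} (hf : fAct g f = -f) (k : ℤ) :
    fAct g (linF a ^ k * f) = (-1) ^ (k + 1) * (linF a ^ k * f) := by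
  rw [map_mul, map_zpow₀, fAct_refl_linF ha hg, hf, neg_eq_neg_one_mul (linF a), mul_zpow,
    zpow_add₀ (by simp)]
  ring

/-- An anti-invariant function never has even order along `α`. -/
lemma zpow_succ_mul_mem (hg : (↑g : Matrix (Fin ℓ) (Fin ℓ) ℝ) = reflMat a)
    {f : Ffield ℓ} (hf : fAct g f = -f) {k : ℤ} (hk : Even k)
    (h : linF a ^ (-k) * f ∈ slocRing a ha) : linF a ^ (-(k + 1)) * f ∈ slocRing a ha := by
  have := inv_mul_mem_of_anti hg h (by
    rw [fAct_zpow_mul ha hg hf, (hk.neg.add_one).neg_one_zpow, neg_one_mul])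
  rwa [← mul_assoc, ← zpow_neg_one, ← zpow_add₀ (linF_ne_zero ha),
    show -1 + -k = -(k + 1) by ring] at this

lemma der_zpow_mul (ha : a ≠ 0) (f : Ffield ℓ) (k : ℤ) :
    linF a ^ (2 - k) * δ f = linF a ^ 2 * δ (linF a ^ (-k) * f)
      + k * (linF a * δ (linF a)) * (linF a ^ (-k) * f) := by
  have h0 := linF_ne_zero ha
  rw [Derivation.leibniz, Derivation.leibniz_zpow]
  simp only [smul_eq_mul, zsmul_eq_mul]
  rw [zpow_sub₀ h0, zpow_sub_one₀ h0, zpow_neg]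
  have : linF a ^ k ≠ 0 := zpow_ne_zero _ h0
  push_cast
  field_simp
  ring

lemma SimplePoleAt.invariant_part (hδ : SimplePoleAt a ha δ)
    (hg : (↑g : Matrix (Fin ℓ) (Fin ℓ) ℝ) = reflMat a) {f : Ffield ℓ} (hf : fAct g f = -f)
    {k : ℤ} (hk : Odd k) (h : linF a ^ (-k) * f ∈ slocRing a ha) :
    δ (linF a ^ (-k) * f) ∈ slocRing a ha :=
  hδ.map_invariant hg h (by
    rw [fAct_zpow_mul ha hg hf, (hk.neg.add_one).neg_one_zpow, one_mul])

/-- A derivation with at most a simple normal pole lowers orders of anti-invariants by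
at most two. -/
lemma SimplePoleAt.map_anti (hδ : SimplePoleAt a ha δ)
    (hg : (↑g : Matrix (Fin ℓ) (Fin ℓ) ℝ) = reflMat a) {f : Ffield ℓ} (hf : fAct g f = -f)
    {k : ℤ} (h : linF a ^ (-k) * f ∈ slocRing a ha) :
    linF a ^ (2 - k) * δ f ∈ slocRing a ha := by
  have hodd : ∀ n : ℤ, Odd n → linF a ^ (-n) * f ∈ slocRing a ha →
      linF a ^ (2 - n) * δ f ∈ slocRing a ha := by
    intro n hn h
    rw [der_zpow_mul ha]
    refine add_mem (mul_mem (pow_mem (toF_mem _) _) (hδ.invariant_part hg hf hn h))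
      (mul_mem (mul_mem (intCast_mem _ _) hδ.normal) h)
  rcases Int.even_or_odd k with hk | hk
  · have h1 := mul_mem (toF_mem (linForm a))
      (hodd (k + 1) hk.add_one (zpow_succ_mul_mem hg hf hk h))
    rwa [← linF, ← mul_assoc, ← zpow_one_add₀ (linF_ne_zero ha),
      show 1 + (2 - (k + 1)) = 2 - k by ring] at h1
  · exact hodd k hk h

/-- If the derivation has a genuine simple pole then orders of anti-invariants drop by
exactly two. -/
lemma SimplePoleAt.mem_of_map_anti (hδ : SimplePoleAt a ha δ) (hpole : δ (linF a) ∉ slocRing a ha)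
    (hg : (↑g : Matrix (Fin ℓ) (Fin ℓ) ℝ) = reflMat a) {f : Ffield ℓ} (hf : fAct g f = -f)
    {N : ℤ} (hN : linF a ^ (-N) * f ∈ slocRing a ha)
    {k : ℤ} (h : linF a ^ (2 - k) * δ f ∈ slocRing a ha) :
    linF a ^ (-k) * f ∈ slocRing a ha := by
  have h0 := linF_ne_zero ha
  have hmono : ∀ {i j : ℤ} {y : Ffield ℓ}, i ≤ j → linF a ^ i * y ∈ slocRing a ha →
      linF a ^ j * y ∈ slocRing a ha := by
    intro i j y hij hy
    obtain ⟨n, rfl⟩ := Int.le.dest hij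
    rw [zpow_add₀ h0, mul_comm (_ ^ i), mul_assoc, zpow_natCast]
    exact mul_mem (pow_mem (toF_mem _) _) hy
  rcases le_total k N with hkN | hkN
  · exact hmono (neg_le_neg hkN) hN
  refine Int.leInduction (m := N) (motive := fun n _ => n ≤ k → linF a ^ (-n) * f ∈ slocRing a ha)
    (fun _ => hN) ?_ k hkN le_rfl
  intro n _ ih hnk
  have hn := ih (by omega)
  rcases Int.even_or_odd n with he | ho
  · exact zpow_succ_mul_mem hg hf he hn
  · have h1 : linF a ^ (2 - (n + 1)) * δ f ∈ slocRing a ha := hmono (by omega) h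
    have hu := hδ.invariant_part hg hf ho hn
    refine mem_sloc_of_mul_mem hδ.normal hpole ?_
    have key : linF a * δ (linF a) * (linF a ^ (-(n + 1)) * f)
        = algebraMap ℝ _ ((n : ℝ)⁻¹) * (linF a ^ (2 - (n + 1)) * δ f
          - linF a * δ (linF a ^ (-n) * f)) := by
      have h2 := der_zpow_mul (δ := δ) ha f n
      have h3 : linF a ^ (2 - (n + 1)) = (linF a)⁻¹ * linF a ^ (2 - n) := by
        rw [← zpow_neg_one, ← zpow_add₀ h0]; congr 1; ring
      have h4 : linF a ^ (-(n + 1)) = (linF a)⁻¹ * linF a ^ (-n) := by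
        rw [← zpow_neg_one, ← zpow_add₀ h0]; congr 1; ring
      have h5 : (n : Ffield ℓ) ≠ 0 := by
        have : n ≠ 0 := by rintro rfl; exact absurd ho (by decide)
        exact_mod_cast this
      rw [h3, h4, mul_assoc (linF a)⁻¹, mul_assoc (linF a)⁻¹, h2, map_inv₀, map_intCast]
      generalize δ (linF a ^ (-n) * f) = w
      generalize linF a ^ (-n) = z
      field_simp
      ring
    rw [key]
    exact mul_mem (algebraMap_mem_sloc _) (sub_mem h1 (mul_mem (toF_mem _) hu))

/-- A derivation tangent to the hyperplane preserves simple poles of anti-invariants. -/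
lemma SimplePoleAt.map_anti_of_tangent (hδ : SimplePoleAt a ha δ)
    (htan : (linF a)⁻¹ * δ (linF a) ∈ slocRing a ha)
    (hg : (↑g : Matrix (Fin ℓ) (Fin ℓ) ℝ) = reflMat a) {f : Ffield ℓ} (hf : fAct g f = -f)
    (h : linF a * f ∈ slocRing a ha) : linF a * δ f ∈ slocRing a ha := by
  have h0 := linF_ne_zero ha
  have hu : δ (linF a * f) ∈ slocRing a ha :=
    hδ.map_invariant hg h (by rw [map_mul, fAct_refl_linF ha hg, hf]; ring)
  have : linF a * δ f = δ (linF a * f) - (linF a)⁻¹ * δ (linF a) * (linF a * f) := by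
    rw [Derivation.leibniz, smul_eq_mul, smul_eq_mul]; field_simp; ring
  rw [this]
  exact sub_mem hu (mul_mem htan h)

end LocalDerivations

section LogarithmicDerivations

variable {ℓ : ℕ} {A : Finset (Fin ℓ → ℝ)}

lemma QF_eq_mul [DecidableEq (Fin ℓ → ℝ)] {a : Fin ℓ → ℝ} (h : a ∈ A) :
    QF A = linF a * toF (∏ b ∈ A.erase a, linForm b) := by
  rw [QF, linF, ← toF_mul, Finset.mul_prod_erase A _ h]

lemma QF_div_linF [DecidableEq (Fin ℓ → ℝ)] {a : Fin ℓ → ℝ} (h : a ∈ A) (ha : a ≠ 0) :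
    QF A / linF a = toF (∏ b ∈ A.erase a, linForm b) := by
  rw [QF_eq_mul h, mul_div_cancel_left₀ _ (linF_ne_zero ha)]

lemma not_linForm_dvd_prod_erase [DecidableEq (Fin ℓ → ℝ)] (hA0 : ∀ a ∈ A, a ≠ 0)
    (hAprop : ∀ a ∈ A, ∀ b ∈ A, (∃ c : ℝ, a = c • b) → a = b) {a : Fin ℓ → ℝ} (h : a ∈ A) :
    ¬ linForm a ∣ ∏ b ∈ A.erase a, linForm b := by
  rw [(linForm_prime (hA0 a h)).dvd_finsetProd_iff]
  rintro ⟨b, hb, hd⟩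
  obtain ⟨hne, hbA⟩ := Finset.mem_erase.1 hb
  exact hne (hAprop b hbA a h (exists_smul_of_linForm_dvd (hA0 a h) (hA0 b hbA) hd))

lemma mem_slocRing_of_QF_div (hA0 : ∀ a ∈ A, a ≠ 0)
    (hAprop : ∀ a ∈ A, ∀ b ∈ A, (∃ c : ℝ, a = c • b) → a = b) {a : Fin ℓ → ℝ} (h : a ∈ A)
    {N : ℕ} {y : Ffield ℓ} (hy : (QF A / linF a) ^ N * y ∈ slocRing a (hA0 a h)) :
    y ∈ slocRing a (hA0 a h) := by
  classical
  have hn := not_linForm_dvd_prod_erase hA0 hAprop h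
  rw [QF_div_linF h (hA0 a h), ← toF_pow] at hy
  have hn' : ¬ linForm a ∣ (∏ b ∈ A.erase a, linForm b) ^ N := fun hd =>
    hn ((linForm_prime (hA0 a h)).dvd_of_dvd_pow hd)
  have h0 : toF ((∏ b ∈ A.erase a, linForm b) ^ N) ≠ 0 :=
    toF_ne_zero (by intro h1; exact hn' (h1 ▸ dvd_zero _))
  have := mul_mem (inv_toF_mem (ha := hA0 a h) hn') hy
  rwa [inv_mul_cancel_left₀ h0] at this

lemma DerInf.tangential (hA0 : ∀ a ∈ A, a ≠ 0)
    (hAprop : ∀ a ∈ A, ∀ b ∈ A, (∃ c : ℝ, a = c • b) → a = b)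
    {ξ : Derivation ℝ (Ffield ℓ) (Ffield ℓ)} (hξ : ξ ∈ DerInf A) {a : Fin ℓ → ℝ} (h : a ∈ A)
    {b : Fin ℓ → ℝ} (hb : ∑ x, a x * b x = 0) : ξ (linF b) ∈ slocRing a (hA0 a h) := by
  obtain ⟨N, -, h2⟩ := hξ
  exact mem_slocRing_of_QF_div hA0 hAprop h (Sreg_subset (h2 a h b hb))

lemma QF_pow_mul_der_linF_mem {ξ : Derivation ℝ (Ffield ℓ) (Ffield ℓ)} {N : ℕ}
    (hN : ∀ x, QF A ^ N * ξ (XF x) ∈ Sreg ℓ) (b : Fin ℓ → ℝ) :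
    QF A ^ N * ξ (linF b) ∈ Sreg ℓ := by
  choose p hp using hN
  refine ⟨∑ x, C (b x) * p x, ?_⟩
  change toF _ = _
  rw [toF_sum, der_linF, Finset.mul_sum]
  refine Finset.sum_congr rfl fun x _ => ?_
  rw [toF_mul, mul_left_comm, ← hp x]
  rfl

lemma DerInf.exists_pow_mul_mem (hA0 : ∀ a ∈ A, a ≠ 0)
    (hAprop : ∀ a ∈ A, ∀ b ∈ A, (∃ c : ℝ, a = c • b) → a = b)
    {ξ : Derivation ℝ (Ffield ℓ) (Ffield ℓ)} (hξ : ξ ∈ DerInf A) {a : Fin ℓ → ℝ} (h : a ∈ A) :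
    ∃ N : ℕ, linF a ^ N * ξ (linF a) ∈ slocRing a (hA0 a h) := by
  classical
  obtain ⟨N, h1, -⟩ := hξ
  refine ⟨N, mem_slocRing_of_QF_div hA0 hAprop h (N := N) ?_⟩
  have := Sreg_subset (ha := hA0 a h) (QF_pow_mul_der_linF_mem h1 a)
  rwa [QF_div_linF h (hA0 a h), ← mul_assoc, ← mul_pow, mul_comm _ (linF a), ← QF_eq_mul h]

/-- Membership in `D(A, m)` is a condition on the order along each hyperplane. -/
lemma mem_DerMult_iff (hA0 : ∀ a ∈ A, a ≠ 0)
    (hAprop : ∀ a ∈ A, ∀ b ∈ A, (∃ c : ℝ, a = c • b) → a = b)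
    {ξ : Derivation ℝ (Ffield ℓ) (Ffield ℓ)} {m : (Fin ℓ → ℝ) → ℤ} :
    ξ ∈ DerMult A m ↔ ξ ∈ DerInf A ∧
      ∀ a (h : a ∈ A), linF a ^ (-m a) * ξ (linF a) ∈ slocRing a (hA0 a h) := by
  classical
  refine ⟨fun ⟨hinf, N, hN⟩ => ⟨hinf, fun a h => ?_⟩, fun ⟨hinf, hloc⟩ => ⟨hinf, ?_⟩⟩
  · obtain ⟨p, hp⟩ := hN a h
    refine mem_slocRing_of_QF_div hA0 hAprop h (N := N) ?_
    rw [mul_left_comm, hp, zpow_neg, inv_mul_cancel_left₀ (zpow_ne_zero _ (linF_ne_zero (hA0 a h)))]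
    exact toF_mem p
  · obtain ⟨N, h1, -⟩ := hinf
    refine ⟨N, fun a h => ?_⟩
    have ha := hA0 a h
    have h0 := linF_ne_zero ha
    obtain ⟨r, hr⟩ := QF_pow_mul_der_linF_mem h1 a
    change toF r = _ at hr
    obtain ⟨p, q, hq, hpq⟩ := hloc a h
    have hq0 : toF q ≠ 0 := toF_ne_zero (by rintro rfl; exact hq (dvd_zero _))
    have hrF : toF r = linF a ^ ((N : ℤ) + m a) * ((QF A / linF a) ^ N *
        (linF a ^ (-m a) * ξ (linF a))) := by
      rw [hr, zpow_add₀ h0, zpow_neg, zpow_natCast, QF_div_linF h ha, QF_eq_mul h]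
      have := zpow_ne_zero (m a) h0
      field_simp
      rw [mul_pow]
      ring
    have key : ∀ s : Spoly ℓ, toF r = linF a ^ ((N : ℤ) + m a) * toF s →
        (QF A / linF a) ^ N * ξ (linF a) = linF a ^ m a * toF s := by
      intro s hs
      rw [hr, QF_eq_mul h, zpow_add₀ h0, zpow_natCast, mul_pow, mul_assoc, mul_assoc] at hs
      rw [QF_div_linF h ha]
      exact mul_left_cancel₀ (pow_ne_zero _ h0) hs
    rcases le_total 0 ((N : ℤ) + m a) with hk | hk
    · obtain ⟨n, hn⟩ := Int.eq_ofNat_of_zero_le hk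
      rw [hn, zpow_natCast] at key hrF
      have hdvd : linForm a ^ n ∣ r * q := by
        refine ⟨(∏ b ∈ A.erase a, linForm b) ^ N * p, toF_injective ?_⟩
        rw [toF_mul, toF_mul, toF_mul, toF_pow, toF_pow, ← hpq, hrF, QF_div_linF h ha, linF]
        ring
      obtain ⟨s, hs⟩ := (linForm_prime ha).pow_dvd_of_dvd_mul_right n hq hdvd
      exact ⟨s, key s (by rw [hs, toF_mul, toF_pow, linF])⟩
    · obtain ⟨n, hn⟩ := Int.exists_eq_neg_ofNat hk
      refine ⟨linForm a ^ n * r, key _ ?_⟩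
      rw [hn, toF_mul, toF_pow, zpow_neg, zpow_natCast, ← linF,
        inv_mul_cancel_left₀ (pow_ne_zero _ h0)]

lemma toF_mem_Sreg (p : Spoly ℓ) : toF p ∈ Sreg ℓ := ⟨p, rfl⟩

variable {W : Subgroup (Matrix.GeneralLinearGroup (Fin ℓ) ℝ)}

lemma InvDer.fAct_apply_linF {ξ : Derivation ℝ (Ffield ℓ) (Ffield ℓ)} (hξ : ξ ∈ InvDer W)
    {g : Matrix.GeneralLinearGroup (Fin ℓ) ℝ} (hgW : g ∈ W)
    (hg : Matrix.transpose (↑g : Matrix (Fin ℓ) (Fin ℓ) ℝ) *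
      (↑g : Matrix (Fin ℓ) (Fin ℓ) ℝ) = 1) (b : Fin ℓ → ℝ) :
    fAct g (ξ (linF b)) = ξ (linF (Matrix.mulVec (↑g : Matrix (Fin ℓ) (Fin ℓ) ℝ) b)) := by
  have h1 : ∀ x, ∑ y, cF ((↑g : Matrix (Fin ℓ) (Fin ℓ) ℝ) x y) * fAct g (ξ (XF y)) = ξ (XF x) :=
    fun x => congrFun (hξ g hgW) x
  have hgt := hg
  set M : Matrix (Fin ℓ) (Fin ℓ) ℝ := (↑g : Matrix (Fin ℓ) (Fin ℓ) ℝ) with hM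
  have h2 : ∀ z, fAct g (ξ (XF z)) = ∑ x, cF (M x z) * ξ (XF x) := by
    intro z
    have : ∀ y, ∑ x, M x z * M x y = if z = y then 1 else 0 := fun y => by
      simpa [Matrix.mul_apply, Matrix.one_apply] using congrFun (congrFun hgt z) y
    calc fAct g (ξ (XF z)) = ∑ y, cF (∑ x, M x z * M x y) * fAct g (ξ (XF y)) := by
          simp [this, cF_eq, apply_ite (algebraMap ℝ (Ffield ℓ))]
      _ = ∑ x, cF (M x z) * ∑ y, cF (M x y) * fAct g (ξ (XF y)) := by
          simp only [cF_eq, map_sum, map_mul, Finset.sum_mul, Finset.mul_sum, mul_assoc]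
          exact Finset.sum_comm
      _ = _ := by simp only [h1]
  rw [der_linF, der_linF, map_sum]
  simp only [map_mul, h2, Matrix.mulVec, dotProduct, cF_eq, fAct_algebraMap, map_sum,
    Finset.sum_mul, Finset.mul_sum]
  rw [Finset.sum_comm]
  refine Finset.sum_congr rfl fun x _ => Finset.sum_congr rfl fun y _ => ?_
  ring

lemma mem_InvDer_of_fAct (hW : ∀ g ∈ W, Matrix.transpose (↑g : Matrix (Fin ℓ) (Fin ℓ) ℝ) *
      (↑g : Matrix (Fin ℓ) (Fin ℓ) ℝ) = 1) {ξ : Derivation ℝ (Ffield ℓ) (Ffield ℓ)}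
    (h : ∀ g ∈ W, ∀ z, fAct g (ξ (XF z)) =
      ∑ x, cF ((↑g : Matrix (Fin ℓ) (Fin ℓ) ℝ) x z) * ξ (XF x)) : ξ ∈ InvDer W := by
  intro g hg
  have hgt := mul_eq_one_comm.1 (hW g hg)
  ext x
  simp only [vecAct, derVec, h g hg]
  set M : Matrix (Fin ℓ) (Fin ℓ) ℝ := (↑g : Matrix (Fin ℓ) (Fin ℓ) ℝ) with hM
  have : ∀ y, ∑ z, M x z * M y z = if x = y then 1 else 0 := fun y => by
    simpa [Matrix.mul_apply, Matrix.one_apply] using congrFun (congrFun hgt x) y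
  calc _ = ∑ y, cF (∑ z, M x z * M y z) * ξ (XF y) := by
        simp only [cF_eq, map_sum, map_mul, Finset.sum_mul, Finset.mul_sum, mul_assoc]
        exact Finset.sum_comm
    _ = _ := by simp [this, cF_eq, apply_ite (algebraMap ℝ (Ffield ℓ))]

lemma mulVec_reflMat_self {a : Fin ℓ → ℝ} (ha : a ≠ 0) : Matrix.mulVec (reflMat a) a = -a := by
  rw [← Matrix.vecMul_transpose, reflMat_transpose, vecMul_reflMat_self ha]

lemma linF_neg (a : Fin ℓ → ℝ) : linF (-a) = -linF a := by
  rw [linF, ← neg_one_smul ℝ a, linForm_smul, linF]; simp [toF_neg]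

lemma InvDer.fAct_refl {ξ : Derivation ℝ (Ffield ℓ) (Ffield ℓ)} (hξ : ξ ∈ InvDer W)
    {g : Matrix.GeneralLinearGroup (Fin ℓ) ℝ} (hgW : g ∈ W) {a : Fin ℓ → ℝ} (ha : a ≠ 0)
    (hg : (↑g : Matrix (Fin ℓ) (Fin ℓ) ℝ) = reflMat a) :
    fAct g (ξ (linF a)) = -ξ (linF a) := by
  rw [InvDer.fAct_apply_linF hξ hgW (by rw [hg, reflMat_transpose, reflMat_mul_self ha]), hg,
    mulVec_reflMat_self ha, linF_neg, map_neg]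

variable {pd : Fin ℓ → Derivation ℝ (Ffield ℓ) (Ffield ℓ)}

lemma der_sum_apply {ι : Type*} (s : Finset ι)
    (δ : ι → Derivation ℝ (Ffield ℓ) (Ffield ℓ)) (y : Ffield ℓ) :
    (∑ i ∈ s, δ i) y = ∑ i ∈ s, δ i y := by
  have h := map_sum (Derivation.coeFnAddMonoidHom :
    Derivation ℝ (Ffield ℓ) (Ffield ℓ) →+ (Ffield ℓ → Ffield ℓ)) δ s
  exact (congrFun h y).trans (Finset.sum_apply _ _ _)

lemma sum_smul_pd_apply (hpd : ∀ x (p : Spoly ℓ), pd x (toF p) = toF (pderiv x p))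
    (f : Fin ℓ → Ffield ℓ) (p : Spoly ℓ) :
    (∑ x, f x • pd x) (toF p) = ∑ x, f x * toF (pderiv x p) := by
  simp [der_sum_apply, hpd]

lemma sum_smul_pd_apply_XF (hpd : ∀ x (p : Spoly ℓ), pd x (toF p) = toF (pderiv x p))
    (f : Fin ℓ → Ffield ℓ) (y : Fin ℓ) :
    (∑ x, f x • pd x) (XF y) = f y := by
  rw [XF, sum_smul_pd_apply hpd]
  simp [pderiv_X, Pi.single_apply, apply_ite toF, toF_one, toF_zero]

lemma nabDer_XF (hpd : ∀ x (p : Spoly ℓ), pd x (toF p) = toF (pderiv x p))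
    (D ξ : Derivation ℝ (Ffield ℓ) (Ffield ℓ)) (x : Fin ℓ) :
    nabDer pd D ξ (XF x) = D (ξ (XF x)) :=
  sum_smul_pd_apply_XF hpd _ x

lemma nabDer_linF (hpd : ∀ x (p : Spoly ℓ), pd x (toF p) = toF (pderiv x p))
    (D ξ : Derivation ℝ (Ffield ℓ) (Ffield ℓ)) (b : Fin ℓ → ℝ) :
    nabDer pd D ξ (linF b) = D (ξ (linF b)) := by
  rw [der_linF, der_linF ξ, map_sum]
  refine Finset.sum_congr rfl fun x _ => ?_
  rw [nabDer_XF hpd, cF_eq, Derivation.leibniz, Derivation.map_algebraMap]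
  simp

lemma der_toF_eq_sum (hpd : ∀ x (p : Spoly ℓ), pd x (toF p) = toF (pderiv x p))
    (δ : Derivation ℝ (Ffield ℓ) (Ffield ℓ)) (p : Spoly ℓ) :
    δ (toF p) = ∑ x, δ (XF x) * toF (pderiv x p) := by
  have h : δ = ∑ x, δ (XF x) • pd x :=
    der_ext_X fun x => (sum_smul_pd_apply_XF hpd (fun y => δ (XF y)) x).symm
  conv_lhs => rw [h]
  exact sum_smul_pd_apply hpd _ p

/-- A derivation with simple poles along the mirrors maps invariants to regular functions. -/
lemma der_invariant_mem_Sreg (hpd : ∀ x (p : Spoly ℓ), pd x (toF p) = toF (pderiv x p))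
    (hA0 : ∀ a ∈ A, a ≠ 0)
    (hrefl : ∀ a ∈ A, ∃ g ∈ W, (↑g : Matrix (Fin ℓ) (Fin ℓ) ℝ) = reflMat a)
    {δ : Derivation ℝ (Ffield ℓ) (Ffield ℓ)} (hδ : δ ∈ DerInf A)
    (hpole : ∀ a (h : a ∈ A), SimplePoleAt a (hA0 a h) δ) {p : Spoly ℓ} (hp : p ∈ InvPoly W) :
    δ (toF p) ∈ Sreg ℓ := by
  obtain ⟨N, hN, -⟩ := hδ
  refine mem_Sreg_of_local hA0 (N := N) ?_ fun a h => ?_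
  · choose q hq using hN
    refine ⟨∑ x, q x * pderiv x p, ?_⟩
    change toF _ = _
    rw [toF_sum, der_toF_eq_sum hpd, Finset.mul_sum]
    refine Finset.sum_congr rfl fun x _ => ?_
    rw [toF_mul, ← mul_assoc, ← hq x]
    rfl
  · obtain ⟨g, hgW, hg⟩ := hrefl a h
    refine (hpole a h).map_invariant hg (toF_mem p) ?_
    rw [fAct_toF, hp _ (inv_mem hgW)]

end LogarithmicDerivations

section MirrorStability

variable {ℓ : ℕ} {A : Finset (Fin ℓ → ℝ)} {W : Subgroup (Matrix.GeneralLinearGroup (Fin ℓ) ℝ)}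
  {pd : Fin ℓ → Derivation ℝ (Ffield ℓ) (Ffield ℓ)}

lemma linF_smul (c : ℝ) (a : Fin ℓ → ℝ) : linF (c • a) = cF c * linF a := by
  rw [linF, linForm_smul, toF_mul, cF, linF]

/-- The Euler derivation. -/
noncomputable def eulerDer (pd : Fin ℓ → Derivation ℝ (Ffield ℓ) (Ffield ℓ)) :
    Derivation ℝ (Ffield ℓ) (Ffield ℓ) := ∑ x, XF x • pd x

lemma eulerDer_XF (hpd : ∀ x (p : Spoly ℓ), pd x (toF p) = toF (pderiv x p)) (x : Fin ℓ) :
    eulerDer pd (XF x) = XF x := sum_smul_pd_apply_XF hpd _ x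

lemma eulerDer_linF (hpd : ∀ x (p : Spoly ℓ), pd x (toF p) = toF (pderiv x p))
    (b : Fin ℓ → ℝ) : eulerDer pd (linF b) = linF b := by
  rw [der_linF, linF_eq]
  simp only [eulerDer_XF hpd]

lemma linF_single (x : Fin ℓ) : linF (Pi.single x 1) = XF x := by rw [linF, linForm_single, XF]

lemma eulerDer_mem (hpd : ∀ x (p : Spoly ℓ), pd x (toF p) = toF (pderiv x p))
    (hW : ∀ g ∈ W, Matrix.transpose (↑g : Matrix (Fin ℓ) (Fin ℓ) ℝ) *
      (↑g : Matrix (Fin ℓ) (Fin ℓ) ℝ) = 1) : eulerDer pd ∈ DerInfW A W := by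
  refine ⟨⟨0, fun x => ?_, fun a _ b _ => ?_⟩, mem_InvDer_of_fAct hW fun g hg z => ?_⟩
  · rw [eulerDer_XF hpd, pow_zero, one_mul]; exact toF_mem_Sreg _
  · rw [eulerDer_linF hpd, pow_zero, one_mul]; exact toF_mem_Sreg _
  · simp only [eulerDer_XF hpd]
    rw [← linF_single, fAct_linF (hW g hg), linF_eq]
    simp

lemma nabDer_eulerDer (hpd : ∀ x (p : Spoly ℓ), pd x (toF p) = toF (pderiv x p))
    (D : Derivation ℝ (Ffield ℓ) (Ffield ℓ)) : nabDer pd D (eulerDer pd) = D :=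
  der_ext_X fun x => by rw [nabDer_XF hpd, eulerDer_XF hpd]

lemma sum_sq_mem_InvPoly (hW : ∀ g ∈ W, Matrix.transpose (↑g : Matrix (Fin ℓ) (Fin ℓ) ℝ) *
      (↑g : Matrix (Fin ℓ) (Fin ℓ) ℝ) = 1) :
    (∑ x, X x * X x : Spoly ℓ) ∈ InvPoly W := by
  intro g hg
  have h := hW g hg
  set M : Matrix (Fin ℓ) (Fin ℓ) ℝ := (↑g : Matrix (Fin ℓ) (Fin ℓ) ℝ) with hM
  have key : ∀ y z, ∑ x, M x y * M x z = if y = z then 1 else 0 := fun y z => by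
    simpa [Matrix.mul_apply, Matrix.one_apply] using congrFun (congrFun h y) z
  calc matSub M (∑ x, X x * X x)
      = ∑ y, ∑ z, C (∑ x, M x y * M x z) * (X y * X z) := by
        simp only [matSub, map_sum, map_mul, aeval_X, Finset.sum_mul, Finset.mul_sum]
        rw [Finset.sum_comm]
        refine Finset.sum_congr rfl fun y _ => ?_
        rw [Finset.sum_comm]
        refine Finset.sum_congr rfl fun z _ => Finset.sum_congr rfl fun x _ => ?_
        ring
    _ = _ := by simp [key, apply_ite C]

lemma SimplePoleAt.of_sum_sq {a : Fin ℓ → ℝ} (ha : a ≠ 0)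
    {δ : Derivation ℝ (Ffield ℓ) (Ffield ℓ)}
    (htan : ∀ b : Fin ℓ → ℝ, ∑ x, a x * b x = 0 → δ (linF b) ∈ slocRing a ha)
    (hsq : δ (toF (∑ x, X x * X x)) ∈ slocRing a ha) : SimplePoleAt a ha δ := by
  refine ⟨htan, ?_⟩
  set n := ∑ y, a y * a y with hn
  have hn0 : n ≠ 0 := sum_sq_ne_zero ha
  have hX : ∀ x, XF x = linF (orthPart a x) + cF (a x / n) * linF a := fun x => by
    rw [XF, X_eq_orthPart a x, toF_add, toF_mul, linF, linF, cF]
  have hδX : ∀ x, δ (XF x) = δ (linF (orthPart a x)) + cF (a x / n) * δ (linF a) := fun x => by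
    rw [hX, map_add, cF_eq, Derivation.leibniz, Derivation.map_algebraMap]
    simp
  have h2 : δ (toF (∑ x, X x * X x)) = 2 * ∑ x, XF x * δ (XF x) := by
    rw [toF_sum, map_sum, Finset.mul_sum]
    refine Finset.sum_congr rfl fun x _ => ?_
    rw [toF_mul, ← XF, Derivation.leibniz, smul_eq_mul]
    ring
  have h3 : ∑ x, XF x * δ (XF x) =
      ∑ x, XF x * δ (linF (orthPart a x)) + cF (1 / n) * (linF a * δ (linF a)) := by
    simp only [hδX, mul_add, Finset.sum_add_distrib]
    congr 1
    have hlin : linF a * δ (linF a) = ∑ x, cF (a x) * XF x * δ (linF a) := by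
      rw [← Finset.sum_mul, ← linF_eq]
    rw [hlin, Finset.mul_sum]
    refine Finset.sum_congr rfl fun x _ => ?_
    rw [div_eq_mul_one_div (a x), cF_eq, map_mul, ← cF_eq, ← cF_eq]
    ring
  have h4 : linF a * δ (linF a) = cF n * (cF (1 / 2) * δ (toF (∑ x, X x * X x))
      - ∑ x, XF x * δ (linF (orthPart a x))) := by
    have e1 : (cF n : Ffield ℓ) * cF (1 / n) = 1 := by
      rw [cF_eq, cF_eq, ← map_mul, mul_one_div_cancel hn0, map_one]
    have e2 : (cF (1 / 2) : Ffield ℓ) * 2 = 1 := by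
      rw [cF_eq, ← map_ofNat (algebraMap ℝ (Ffield ℓ)) 2, ← map_mul]; norm_num
    rw [h2, ← mul_assoc (cF (1 / 2)), e2, one_mul, h3, add_sub_cancel_left, ← mul_assoc, e1,
      one_mul]
  rw [h4]
  refine mul_mem (toF_mem _) (sub_mem (mul_mem (toF_mem _) hsq) (sum_mem fun x _ => ?_))
  exact mul_mem (toF_mem _) (htan _ (orthPart_orthogonal ha x))

/-- The derivation `∑ₕ α_h⁻¹ I*(dα_h)` attached to a set of hyperplanes. -/
noncomputable def poleDer (pd : Fin ℓ → Derivation ℝ (Ffield ℓ) (Ffield ℓ))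
    (B : Finset (Fin ℓ → ℝ)) : Derivation ℝ (Ffield ℓ) (Ffield ℓ) :=
  ∑ x, (∑ b ∈ B, cF (b x) * (linF b)⁻¹) • pd x

lemma poleDer_XF (hpd : ∀ x (p : Spoly ℓ), pd x (toF p) = toF (pderiv x p))
    (B : Finset (Fin ℓ → ℝ)) (x : Fin ℓ) :
    poleDer pd B (XF x) = ∑ b ∈ B, cF (b x) * (linF b)⁻¹ := sum_smul_pd_apply_XF hpd _ x

lemma poleDer_linF (hpd : ∀ x (p : Spoly ℓ), pd x (toF p) = toF (pderiv x p))
    (B : Finset (Fin ℓ → ℝ)) (c : Fin ℓ → ℝ) :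
    poleDer pd B (linF c) = ∑ b ∈ B, cF (∑ x, b x * c x) * (linF b)⁻¹ := by
  rw [der_linF]
  simp only [poleDer_XF hpd, cF_eq, map_sum, map_mul, Finset.sum_mul, Finset.mul_sum]
  rw [Finset.sum_comm]
  refine Finset.sum_congr rfl fun b _ => Finset.sum_congr rfl fun x _ => ?_
  ring

lemma poleDer_mem_DerInf (hpd : ∀ x (p : Spoly ℓ), pd x (toF p) = toF (pderiv x p))
    (hA0 : ∀ a ∈ A, a ≠ 0) {B : Finset (Fin ℓ → ℝ)} (hB : B ⊆ A) : poleDer pd B ∈ DerInf A := by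
  classical
  refine ⟨1, fun x => ?_, fun a ha c hc => ?_⟩
  · rw [poleDer_XF hpd, pow_one, Finset.mul_sum]
    refine sum_mem (S := (algebraMap (Spoly ℓ) (Ffield ℓ)).range) fun b hb => ?_
    have h0 := linF_ne_zero (hA0 b (hB hb))
    rw [QF_eq_mul (hB hb), show ∀ u v w : Ffield ℓ, u * v * (w * u⁻¹) = (u * u⁻¹) * (v * w) by
      intros; ring, mul_inv_cancel₀ h0, one_mul, cF, ← toF_mul]
    exact toF_mem_Sreg _
  · rw [poleDer_linF hpd, pow_one, Finset.mul_sum]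
    refine sum_mem (S := (algebraMap (Spoly ℓ) (Ffield ℓ)).range) fun b hb => ?_
    by_cases hab : b = a
    · rw [hab, hc, cF_eq, map_zero, zero_mul, mul_zero]; exact zero_mem _
    · have h0 := linF_ne_zero (hA0 b (hB hb))
      rw [QF_div_linF ha (hA0 a ha),
        ← Finset.mul_prod_erase (A.erase a) linForm (Finset.mem_erase.2 ⟨hab, hB hb⟩), toF_mul,
        ← linF, show ∀ u v w : Ffield ℓ, u * v * (w * u⁻¹) = (u * u⁻¹) * (v * w) by
          intros; ring, mul_inv_cancel₀ h0, one_mul, cF, ← toF_mul]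
      exact toF_mem_Sreg _

lemma cF_ne_zero {c : ℝ} (hc : c ≠ 0) : (cF c : Ffield ℓ) ≠ 0 := toF_ne_zero (C_ne_zero.2 hc)

lemma poleDer_mem_InvDer (hpd : ∀ x (p : Spoly ℓ), pd x (toF p) = toF (pderiv x p))
    (hW : ∀ g ∈ W, Matrix.transpose (↑g : Matrix (Fin ℓ) (Fin ℓ) ℝ) *
      (↑g : Matrix (Fin ℓ) (Fin ℓ) ℝ) = 1) {B : Finset (Fin ℓ → ℝ)}
    (hprop : ∀ a ∈ B, ∀ b ∈ B, (∃ c : ℝ, a = c • b) → a = b)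
    (hstab : ∀ g ∈ W, ∀ b ∈ B, ∃ b' ∈ B, ∃ c : ℝ, c ≠ 0 ∧
      Matrix.mulVec (↑g : Matrix (Fin ℓ) (Fin ℓ) ℝ) b = c • b') : poleDer pd B ∈ InvDer W := by
  refine mem_InvDer_of_fAct hW fun g hg z => ?_
  have hgt := hW g hg
  choose σ hσB c hc0 hc using hstab g hg
  have hinv : ∀ b, Matrix.vecMul (Matrix.mulVec (↑g : Matrix (Fin ℓ) (Fin ℓ) ℝ) b)
      (↑g : Matrix (Fin ℓ) (Fin ℓ) ℝ) = b := fun b => by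
    rw [← Matrix.mulVec_transpose, Matrix.mulVec_mulVec, hgt, Matrix.one_mulVec]
  have hback : ∀ b (hb : b ∈ B), b = c b hb •
      Matrix.vecMul (σ b hb) (↑g : Matrix (Fin ℓ) (Fin ℓ) ℝ) := fun b hb => by
    rw [← Matrix.smul_vecMul, ← hc, hinv]
  have hinj : ∀ b (hb : b ∈ B) b' (hb' : b' ∈ B), σ b hb = σ b' hb' → b = b' := by
    intro b hb b' hb' h
    refine hprop b hb b' hb' ⟨c b hb * (c b' hb')⁻¹, ?_⟩
    rw [mul_smul, (inv_smul_eq_iff₀ (hc0 b' hb')).2 (hback b' hb'), ← h]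
    exact hback b hb
  simp only [poleDer_XF hpd, map_sum, map_mul, map_inv₀, fAct_linF hgt, Finset.mul_sum]
  rw [Finset.sum_comm]
  refine Finset.sum_bij σ hσB hinj
    (fun b hb => ?_) fun b hb => ?_
  · obtain ⟨a, ha, h⟩ := Finset.surj_on_of_inj_on_of_card_le σ hσB
      (fun _ _ ha hb h => hinj _ ha _ hb h) le_rfl b hb
    exact ⟨a, ha, h.symm⟩
  · have h1 : fAct g (cF (b z)) = cF (c b hb) *
        ∑ x, cF (σ b hb x) * cF ((↑g : Matrix (Fin ℓ) (Fin ℓ) ℝ) x z) := by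
      have hz : b z = c b hb * ∑ x, σ b hb x * (↑g : Matrix (Fin ℓ) (Fin ℓ) ℝ) x z := by
        simpa [Matrix.vecMul, dotProduct] using congrFun (hback b hb) z
      rw [cF_eq, fAct_algebraMap, hz]
      simp [cF_eq]
    rw [h1, hc b hb, linF_smul, mul_inv, show ∀ u v w s : Ffield ℓ, u * v * (w * s) = (u * w) * (v * s)
      by intros; ring, mul_inv_cancel₀ (cF_ne_zero (hc0 b hb)), one_mul, Finset.sum_mul]
    refine Finset.sum_congr rfl fun x _ => ?_
    ring

/-- The hyperplanes of a Coxeter arrangement are permuted by the group. -/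
lemma exists_smul_eq_mulVec
    (hW : ∀ g ∈ W, Matrix.transpose (↑g : Matrix (Fin ℓ) (Fin ℓ) ℝ) *
      (↑g : Matrix (Fin ℓ) (Fin ℓ) ℝ) = 1) (hA0 : ∀ a ∈ A, a ≠ 0)
    (hrefl : ∀ a ∈ A, ∃ g ∈ W, (↑g : Matrix (Fin ℓ) (Fin ℓ) ℝ) = reflMat a)
    (hhyp : ∀ g ∈ W, ∀ a : Fin ℓ → ℝ, a ≠ 0 → (↑g : Matrix (Fin ℓ) (Fin ℓ) ℝ) = reflMat a →
      ∃ b ∈ A, ∃ c : ℝ, a = c • b)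
    {g : Matrix.GeneralLinearGroup (Fin ℓ) ℝ} (hg : g ∈ W) {a : Fin ℓ → ℝ} (ha : a ∈ A) :
    ∃ b ∈ A, ∃ c : ℝ, c ≠ 0 ∧ Matrix.mulVec (↑g : Matrix (Fin ℓ) (Fin ℓ) ℝ) a = c • b := by
  have hgt := hW g hg
  obtain ⟨s, hs, hsa⟩ := hrefl a ha
  have h0 : Matrix.mulVec (↑g : Matrix (Fin ℓ) (Fin ℓ) ℝ) a ≠ 0 := fun h => hA0 a ha <| by
    rw [← Matrix.one_mulVec a, ← hgt, ← Matrix.mulVec_mulVec, h, Matrix.mulVec_zero]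
  have hdot : ∑ x, Matrix.mulVec (↑g : Matrix (Fin ℓ) (Fin ℓ) ℝ) a x *
      Matrix.mulVec (↑g : Matrix (Fin ℓ) (Fin ℓ) ℝ) a x = ∑ x, a x * a x := by
    change Matrix.mulVec (↑g : Matrix (Fin ℓ) (Fin ℓ) ℝ) a ⬝ᵥ
      Matrix.mulVec (↑g : Matrix (Fin ℓ) (Fin ℓ) ℝ) a = a ⬝ᵥ a
    rw [Matrix.dotProduct_mulVec, ← Matrix.mulVec_transpose, Matrix.mulVec_mulVec, hgt,
      Matrix.one_mulVec]
  have hmat : (↑(g * s * g⁻¹) : Matrix (Fin ℓ) (Fin ℓ) ℝ)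
      = reflMat (Matrix.mulVec (↑g : Matrix (Fin ℓ) (Fin ℓ) ℝ) a) := by
    rw [Units.val_mul, Units.val_mul, hsa, coe_inv_of_orthogonal hgt, reflMat, reflMat, hdot,
      Matrix.mul_sub, Matrix.sub_mul, Matrix.mul_one, mul_eq_one_comm.1 hgt, Matrix.mul_smul,
      Matrix.smul_mul, Matrix.mul_vecMulVec, Matrix.vecMulVec_mul, Matrix.vecMul_transpose]
  obtain ⟨b, hb, c, hc⟩ := hhyp _ (mul_mem (mul_mem hg hs) (inv_mem hg)) _ h0 hmat
  exact ⟨b, hb, c, by rintro rfl; exact h0 (by rw [hc, zero_smul]), hc⟩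

lemma der_linF_mem_of_mulVec {D : Derivation ℝ (Ffield ℓ) (Ffield ℓ)} (hD : D ∈ InvDer W)
    {g : Matrix.GeneralLinearGroup (Fin ℓ) ℝ} (hg : g ∈ W)
    (hgt : Matrix.transpose (↑g : Matrix (Fin ℓ) (Fin ℓ) ℝ) *
      (↑g : Matrix (Fin ℓ) (Fin ℓ) ℝ) = 1) {a b : Fin ℓ → ℝ} {c : ℝ} (hc0 : c ≠ 0)
    (hc : Matrix.mulVec (↑g : Matrix (Fin ℓ) (Fin ℓ) ℝ) a = c • b)
    (h : D (linF a) ∈ Sloc a) : D (linF b) ∈ Sloc b := by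
  obtain ⟨p, q, hq, hpq⟩ := h
  refine ⟨C c⁻¹ * matSub (↑g⁻¹ : Matrix (Fin ℓ) (Fin ℓ) ℝ) p,
    matSub (↑g⁻¹ : Matrix (Fin ℓ) (Fin ℓ) ℝ) q, ?_, ?_⟩
  · rintro ⟨r, hr⟩
    refine hq ?_
    have h1 : matSub (↑g : Matrix (Fin ℓ) (Fin ℓ) ℝ) (matSub (↑g⁻¹ : Matrix (Fin ℓ) (Fin ℓ) ℝ) q)
        = q := by
      rw [← AlgHom.comp_apply, matSub_comp, ← Units.val_mul, inv_mul_cancel, Units.val_one,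
        matSub_one, AlgHom.id_apply]
    rw [← h1, hr, map_mul, matSub_linForm]
    have h2 : Matrix.vecMul b (↑g : Matrix (Fin ℓ) (Fin ℓ) ℝ) = c⁻¹ • a := by
      rw [← inv_smul_smul₀ hc0 b, ← hc, Matrix.smul_vecMul, ← Matrix.mulVec_transpose,
        Matrix.mulVec_mulVec, hgt, Matrix.one_mulVec]
    rw [h2, linForm_smul]
    exact ⟨C c⁻¹ * matSub (↑g : Matrix (Fin ℓ) (Fin ℓ) ℝ) r, by ring⟩
  · have h3 := congrArg (fAct g) hpq
    rw [map_mul, InvDer.fAct_apply_linF hD hg hgt, hc, linF_smul, cF_eq, Derivation.leibniz,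
      Derivation.map_algebraMap, smul_zero, add_zero, smul_eq_mul, fAct_toF, fAct_toF] at h3
    rw [toF_mul, ← h3, toF_C, ← mul_assoc, ← mul_assoc, ← map_mul, inv_mul_cancel₀ hc0, map_one,
      one_mul]

end MirrorStability

section PrimitiveDerivation

variable {ℓ t : ℕ} {pd : Fin ℓ → Derivation ℝ (Ffield ℓ) (Ffield ℓ)}

lemma eulerDer_toF_of_isHomogeneous
    (hpd : ∀ x (p : Spoly ℓ), pd x (toF p) = toF (pderiv x p)) {p : Spoly ℓ} {n : ℕ}
    (hp : p.IsHomogeneous n) : eulerDer pd (toF p) = (n : ℝ) • toF p := by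
  rw [eulerDer, sum_smul_pd_apply hpd]
  simp only [XF, ← toF_mul, ← toF_sum]
  rw [hp.sum_X_mul_pderiv, nsmul_eq_mul, toF_mul, Algebra.smul_def]
  simp [toF]

/-- Polynomials have no negative Euler weights. -/
lemma eq_zero_of_eulerDer_eq_smul
    (hpd : ∀ x (p : Spoly ℓ), pd x (toF p) = toF (pderiv x p)) {p : Spoly ℓ} {r : ℝ} (hr : r < 0)
    (h : eulerDer pd (toF p) = r • toF p) : p = 0 := by
  have h1 : ∑ x, X x * pderiv x p = C r * p := by
    apply toF_injective
    rw [toF_mul, toF_C, ← Algebra.smul_def, ← h, eulerDer, sum_smul_pd_apply hpd]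
    simp only [XF, ← toF_mul, ← toF_sum]
  ext m
  have h2 := congrArg (coeff m) h1
  have h3 : ∀ x, coeff m (X x * pderiv x p) = m x * coeff m p := by
    intro x
    classical
    rw [coeff_X_mul']
    split_ifs with hx
    · rw [coeff_pderiv]
      have hx1 : 1 ≤ m x := Nat.one_le_iff_ne_zero.2 (Finsupp.mem_support_iff.1 hx)
      rw [tsub_add_cancel_of_le (Finsupp.single_le_iff.2 hx1), Finsupp.tsub_apply,
        Finsupp.single_eq_same, Nat.cast_sub hx1, Nat.cast_one, sub_add_cancel, mul_comm]
    · simp [Finsupp.notMem_support_iff.1 hx]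
  rw [coeff_sum, coeff_C_mul] at h2
  simp only [h3, ← Finset.sum_mul] at h2
  rw [coeff_zero]
  have h4 : (0 : ℝ) ≤ ∑ x, (m x : ℝ) := by positivity
  have h5 : (∑ x, (m x : ℝ) - r) * coeff m p = 0 := by linear_combination h2
  exact (mul_eq_zero.1 h5).resolve_left (by linarith)

variable {cox : CoxeterSetup ℓ t} {DFi : Fin t → Derivation ℝ (Ffield ℓ) (Ffield ℓ)}

lemma eulerDer_DFi (hDFi : ∀ i c, DFi i (toF (cox.P c)) = if c = cox.top i then 1 else 0)
    (hpd : ∀ x (p : Spoly ℓ), pd x (toF p) = toF (pderiv x p)) (i : Fin t) (y : Ffield ℓ) :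
    eulerDer pd (DFi i y) = DFi i (eulerDer pd y) - (cox.deg (cox.top i) : ℝ) • DFi i y := by
  have h : ⁅eulerDer pd, DFi i⁆ + (cox.deg (cox.top i) : ℝ) • DFi i = 0 := by
    refine der_eq_zero_of_algebraicIndependent cox.hPind _ fun c => ?_
    rw [Derivation.add_apply, Derivation.commutator_apply, Derivation.smul_apply, hDFi,
      eulerDer_toF_of_isHomogeneous hpd (cox.hPhom c), Derivation.map_smul, hDFi]
    split_ifs with hc
    · simp [hc]
    · simp
  have h1 := congrArg (fun δ : Derivation ℝ (Ffield ℓ) (Ffield ℓ) => δ y) h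
  simp only [Derivation.add_apply, Derivation.commutator_apply, Derivation.smul_apply,
    Derivation.zero_apply] at h1
  linear_combination h1

lemma pderiv_P_eq_zero {x c : Fin ℓ} (h : cox.blk x ≠ cox.blk c) :
    pderiv x (cox.P c) = 0 := by
  refine pderiv_eq_zero_of_notMem_vars fun hx => ?_
  obtain ⟨m, hm, hxm⟩ := (mem_vars_iff_mem_support x).1 hx
  exact h (cox.hPblock c m hm x hxm)

lemma DFi_XF_eq_zero (hDFi : ∀ i c, DFi i (toF (cox.P c)) = if c = cox.top i then 1 else 0)
    (hpd : ∀ x (p : Spoly ℓ), pd x (toF p) = toF (pderiv x p)) {j : Fin t} {x : Fin ℓ}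
    (hx : cox.blk x ≠ j) : DFi j (XF x) = 0 := by
  have h : (∑ y, (if cox.blk y = cox.blk x then DFi j (XF y) else 0) • pd y) = 0 := by
    refine der_eq_zero_of_algebraicIndependent cox.hPind _ fun c => ?_
    rw [sum_smul_pd_apply hpd]
    by_cases hc : cox.blk c = cox.blk x
    · have h1 := der_toF_eq_sum hpd (DFi j) (cox.P c)
      rw [hDFi, if_neg (by rintro rfl; exact hx (hc.symm.trans (cox.htop j)))] at h1
      rw [h1]
      refine Finset.sum_congr rfl fun y _ => ?_
      split_ifs with hy
      · rfl
      · rw [pderiv_P_eq_zero (by rwa [hc]), toF_zero, mul_zero, mul_zero]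
    · refine Finset.sum_eq_zero fun y _ => ?_
      split_ifs with hy
      · rw [pderiv_P_eq_zero (by rw [hy]; exact Ne.symm hc), toF_zero, mul_zero]
      · rw [zero_mul]
  have h1 := congrArg (fun δ : Derivation ℝ (Ffield ℓ) (Ffield ℓ) => δ (XF x)) h
  simpa only [sum_smul_pd_apply_XF hpd, if_true, Derivation.zero_apply] using h1

lemma DFi_poleDer_XF_eq_zero
    (hDFi : ∀ i c, DFi i (toF (cox.P c)) = if c = cox.top i then 1 else 0)
    (hpd : ∀ x (p : Spoly ℓ), pd x (toF p) = toF (pderiv x p)) {B : Finset (Fin ℓ → ℝ)}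
    (hB : B ⊆ cox.A) {j : Fin t} {x : Fin ℓ} (hx : cox.blk x ≠ j) :
    DFi j (poleDer pd B (XF x)) = 0 := by
  rw [poleDer_XF hpd, map_sum]
  refine Finset.sum_eq_zero fun b hb => ?_
  by_cases hbx : b x = 0
  · simp [hbx, cF_eq]
  obtain ⟨i, hi⟩ := cox.hblkA b (hB hb)
  have h0 : DFi j (linF b) = 0 := by
    rw [der_linF]
    refine Finset.sum_eq_zero fun y _ => ?_
    by_cases hby : b y = 0
    · simp [hby, cF_eq]
    · rw [DFi_XF_eq_zero hDFi hpd (by rw [hi y hby, ← hi x hbx]; exact hx), mul_zero]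
  rw [cF_eq, Derivation.leibniz, Derivation.map_algebraMap, Derivation.leibniz_inv, h0]
  simp

lemma eulerDer_poleDer_XF (hpd : ∀ x (p : Spoly ℓ), pd x (toF p) = toF (pderiv x p))
    {B : Finset (Fin ℓ → ℝ)} (hB : ∀ b ∈ B, b ≠ 0) (x : Fin ℓ) :
    eulerDer pd (poleDer pd B (XF x)) = -poleDer pd B (XF x) := by
  rw [poleDer_XF hpd, map_sum, ← Finset.sum_neg_distrib]
  refine Finset.sum_congr rfl fun b hb => ?_
  have h0 := linF_ne_zero (hB b hb)
  rw [cF_eq, Derivation.leibniz, Derivation.map_algebraMap, Derivation.leibniz_inv,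
    eulerDer_linF hpd]
  simp only [smul_eq_mul, mul_zero, add_zero]
  field_simp

lemma eq_empty_of_poleDer_eq_zero
    (hpd : ∀ x (p : Spoly ℓ), pd x (toF p) = toF (pderiv x p)) {B : Finset (Fin ℓ → ℝ)}
    (hB : ∀ b ∈ B, b ≠ 0) (h : poleDer pd B = 0) : B = ∅ := by
  have h1 : ∑ x, XF x * poleDer pd B (XF x) = (B.card : Ffield ℓ) := by
    simp only [poleDer_XF hpd, Finset.mul_sum]
    rw [Finset.sum_comm, Finset.card_eq_sum_ones, Nat.cast_sum]
    refine Finset.sum_congr rfl fun b hb => ?_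
    rw [Nat.cast_one, ← mul_inv_cancel₀ (linF_ne_zero (hB b hb)), linF_eq b, Finset.sum_mul]
    refine Finset.sum_congr rfl fun x _ => ?_
    ring
  rw [h] at h1
  simpa using h1.symm

/-- The derivation `∇_D η`, with `η = ∑ₕ α_h⁻¹ I*(dα_h)`, lowers the degrees of the basic
invariants too much to map one of them to a nonzero polynomial. -/
lemma nabDer_poleDer_eq_zero
    (hDFi : ∀ i c, DFi i (toF (cox.P c)) = if c = cox.top i then 1 else 0)
    {D : Derivation ℝ (Ffield ℓ) (Ffield ℓ)} (hD : D = ∑ i, DFi i)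
    (hpd : ∀ x (p : Spoly ℓ), pd x (toF p) = toF (pderiv x p)) {B : Finset (Fin ℓ → ℝ)}
    (hB : B ⊆ cox.A) (hreg : ∀ c, nabDer pd D (poleDer pd B) (toF (cox.P c)) ∈ Sreg ℓ) :
    nabDer pd D (poleDer pd B) = 0 := by
  refine der_eq_zero_of_algebraicIndependent cox.hPind _ fun c => ?_
  obtain ⟨p, hp⟩ := hreg c
  change toF p = _ at hp
  have hDX : ∀ x, D (poleDer pd B (XF x)) = DFi (cox.blk x) (poleDer pd B (XF x)) := by
    intro x
    rw [hD, der_sum_apply]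
    exact Finset.sum_eq_single _
      (fun j _ hj => DFi_poleDer_XF_eq_zero hDFi hpd hB hj.symm) (by simp)
  have hsum : toF p = ∑ x, DFi (cox.blk c) (poleDer pd B (XF x)) * toF (pderiv x (cox.P c)) := by
    rw [hp, der_toF_eq_sum hpd]
    refine Finset.sum_congr rfl fun x _ => ?_
    rw [nabDer_XF hpd, hDX]
    by_cases hx : cox.blk x = cox.blk c
    · rw [hx]
    · rw [pderiv_P_eq_zero hx, toF_zero, mul_zero, mul_zero]
  have hle : cox.deg c ≤ cox.deg (cox.top (cox.blk c)) := by
    by_cases hc : c = cox.top (cox.blk c)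
    · rw [← hc]
    · exact (cox.htopdeg _ c rfl hc).le
  have heig : eulerDer pd (toF p)
      = ((cox.deg c : ℝ) - 2 - cox.deg (cox.top (cox.blk c))) • toF p := by
    conv_lhs => rw [hsum, map_sum]
    rw [hsum, Finset.smul_sum]
    refine Finset.sum_congr rfl fun x _ => ?_
    rw [Derivation.leibniz, eulerDer_DFi hDFi hpd,
      eulerDer_poleDer_XF hpd (fun b hb => cox.hA0 b (hB hb)), map_neg,
      eulerDer_toF_of_isHomogeneous hpd (cox.hPhom c).pderiv, Nat.cast_sub (cox.hdeg c)]
    simp only [smul_eq_mul]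
    simp only [Algebra.smul_def, map_sub, map_natCast, map_ofNat, Nat.cast_one, map_one]
    ring
  have h1 : (cox.deg c : ℝ) ≤ cox.deg (cox.top (cox.blk c)) := by exact_mod_cast hle
  rw [← hp, eq_zero_of_eulerDer_eq_smul hpd (by linarith) heig, toF_zero]

end PrimitiveDerivation

section PrimitiveOrders

variable {ℓ t : ℕ} {pd : Fin ℓ → Derivation ℝ (Ffield ℓ) (Ffield ℓ)}
  {cox : CoxeterSetup ℓ t} {DFi : Fin t → Derivation ℝ (Ffield ℓ) (Ffield ℓ)}
  {D : Derivation ℝ (Ffield ℓ) (Ffield ℓ)}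

lemma primitive_toF_mem_Sreg
    (hDFi : ∀ i c, DFi i (toF (cox.P c)) = if c = cox.top i then 1 else 0)
    (hD : D = ∑ i, DFi i) {p : Spoly ℓ} (hp : p ∈ InvPoly cox.W) : D (toF p) ∈ Sreg ℓ := by
  have hp' := (cox.hPgen p).1 hp
  change _ ∈ (algebraMap (Spoly ℓ) (Ffield ℓ)).range
  induction hp' using Algebra.adjoin_induction with
  | mem x hx =>
    obtain ⟨c, rfl⟩ := hx
    rw [hD, der_sum_apply]
    refine sum_mem fun i _ => ?_
    rw [hDFi]
    split_ifs
    · exact one_mem _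
    · exact zero_mem _
  | algebraMap r =>
    rw [algebraMap_eq, toF_C, Derivation.map_algebraMap]
    exact zero_mem _
  | add x y hx hy h h' =>
    rw [toF_add, map_add]
    exact add_mem (h ((cox.hPgen x).2 hx)) (h' ((cox.hPgen y).2 hy))
  | mul x y hx hy h h' =>
    rw [toF_mul, Derivation.leibniz, smul_eq_mul, smul_eq_mul]
    exact add_mem (mul_mem ⟨x, rfl⟩ (h' ((cox.hPgen y).2 hy)))
      (mul_mem ⟨y, rfl⟩ (h ((cox.hPgen x).2 hx)))

lemma simplePoleAt_primitive
    (hDFi : ∀ i c, DFi i (toF (cox.P c)) = if c = cox.top i then 1 else 0)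
    (hD : D = ∑ i, DFi i) (hDinf : D ∈ DerInf cox.A) {a : Fin ℓ → ℝ} (h : a ∈ cox.A) :
    SimplePoleAt a (cox.hA0 a h) D :=
  .of_sum_sq _ (fun _ hb => DerInf.tangential cox.hA0 cox.hAprop hDinf h hb)
    (Sreg_subset (primitive_toF_mem_Sreg hDFi hD (sum_sq_mem_InvPoly cox.hWorth)))

/-- A primitive derivation has a pole along every hyperplane, provided `∇_D` is a bijection
of `D(A, -∞)^W`. -/
lemma primitive_linF_notMem
    (hDFi : ∀ i c, DFi i (toF (cox.P c)) = if c = cox.top i then 1 else 0)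
    (hD : D = ∑ i, DFi i) (hpd : ∀ x (p : Spoly ℓ), pd x (toF p) = toF (pderiv x p))
    (hDinf : D ∈ DerInfW cox.A cox.W)
    (hmap : ∀ ξ ∈ DerInfW cox.A cox.W, nabDer pd D ξ ∈ DerInfW cox.A cox.W)
    (hinj : ∀ ξ ∈ DerInfW cox.A cox.W, nabDer pd D ξ = 0 → ξ = 0)
    {a : Fin ℓ → ℝ} (h : a ∈ cox.A) : D (linF a) ∉ slocRing a (cox.hA0 a h) := by
  classical
  set B := cox.A.filter fun b => D (linF b) ∈ Sloc b with hBdef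
  have hB : B ⊆ cox.A := Finset.filter_subset _ _
  have hB0 : ∀ b ∈ B, b ≠ 0 := fun b hb => cox.hA0 b (hB hb)
  have hη : poleDer pd B ∈ DerInfW cox.A cox.W := by
    refine ⟨poleDer_mem_DerInf hpd cox.hA0 hB, poleDer_mem_InvDer hpd cox.hWorth
      (fun b hb c hc => cox.hAprop b (hB hb) c (hB hc)) fun g hg b hb => ?_⟩
    obtain ⟨hbA, hbD⟩ := Finset.mem_filter.1 hb
    obtain ⟨b', hb', c, hc0, hc⟩ :=
      exists_smul_eq_mulVec cox.hWorth cox.hA0 cox.hrefl cox.hhyp hg hbA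
    exact ⟨b', Finset.mem_filter.2 ⟨hb', der_linF_mem_of_mulVec hDinf.2 hg (cox.hWorth g hg)
      hc0 hc hbD⟩, c, hc0, hc⟩
  have hη1 : ∀ a (h : a ∈ cox.A),
      linF a * poleDer pd B (linF a) ∈ slocRing a (cox.hA0 a h) ∧
        (a ∉ B → poleDer pd B (linF a) ∈ slocRing a (cox.hA0 a h)) := by
    intro a h
    have hterm : ∀ b ∈ B, b ≠ a → (linF b)⁻¹ ∈ slocRing a (cox.hA0 a h) := fun b hb hne =>
      inv_toF_mem fun hd => hne (cox.hAprop b (hB hb) a h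
        (exists_smul_of_linForm_dvd (cox.hA0 a h) (hB0 b hb) hd))
    rw [poleDer_linF hpd, Finset.mul_sum]
    refine ⟨sum_mem fun b hb => ?_, fun ha => sum_mem fun b hb =>
      mul_mem (toF_mem _) (hterm b hb (by rintro rfl; exact ha hb))⟩
    by_cases hba : b = a
    · rw [hba, mul_left_comm, mul_inv_cancel₀ (linF_ne_zero (cox.hA0 a h)), mul_one]
      exact toF_mem _
    · exact mul_mem (toF_mem _) (mul_mem (toF_mem _) (hterm b hb hba))
  have hζ := hmap _ hη
  have hζpole : ∀ a (h : a ∈ cox.A),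
      SimplePoleAt a (cox.hA0 a h) (nabDer pd D (poleDer pd B)) := by
    intro a h
    refine ⟨fun b hb => DerInf.tangential cox.hA0 cox.hAprop hζ.1 h hb, ?_⟩
    rw [nabDer_linF hpd]
    obtain ⟨g, hgW, hg⟩ := cox.hrefl a h
    have hDa := simplePoleAt_primitive hDFi hD hDinf.1 h
    have hanti := InvDer.fAct_refl hη.2 hgW (cox.hA0 a h) hg
    by_cases haB : a ∈ B
    · refine hDa.map_anti_of_tangent ?_ hg hanti (hη1 a h).1
      exact inv_mul_mem_of_anti hg (Finset.mem_filter.1 haB).2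
        (InvDer.fAct_refl hDinf.2 hgW (cox.hA0 a h) hg)
    · have h1 := inv_mul_mem_of_anti hg ((hη1 a h).2 haB) hanti
      have h2 := hDa.map_anti hg hanti (k := 1) (by rwa [zpow_neg_one])
      rwa [show (2 : ℤ) - 1 = 1 by norm_num, zpow_one] at h2
  have hζ0 := nabDer_poleDer_eq_zero hDFi hD hpd hB fun c =>
    der_invariant_mem_Sreg hpd cox.hA0 cox.hrefl hζ.1 hζpole (cox.hPinv c)
  have hBe := eq_empty_of_poleDer_eq_zero hpd hB0 (hinj _ hη hζ0)
  intro hmem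
  have : a ∈ B := Finset.mem_filter.2 ⟨h, hmem⟩
  rw [hBe] at this
  exact absurd this (Finset.notMem_empty a)

/-- `∇_D` shifts the order along every hyperplane by exactly two. -/
lemma nabDer_mem_DerMult_iff
    (hDFi : ∀ i c, DFi i (toF (cox.P c)) = if c = cox.top i then 1 else 0)
    (hD : D = ∑ i, DFi i) (hpd : ∀ x (p : Spoly ℓ), pd x (toF p) = toF (pderiv x p))
    (hDinf : D ∈ DerInfW cox.A cox.W)
    (hpole : ∀ a (h : a ∈ cox.A), D (linF a) ∉ slocRing a (cox.hA0 a h))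
    {ξ : Derivation ℝ (Ffield ℓ) (Ffield ℓ)} (hξ : ξ ∈ DerInfW cox.A cox.W)
    (hDξ : nabDer pd D ξ ∈ DerInfW cox.A cox.W) (m : (Fin ℓ → ℝ) → ℤ) :
    nabDer pd D ξ ∈ DerMult cox.A (fun a => m a - 2) ↔ ξ ∈ DerMult cox.A m := by
  rw [mem_DerMult_iff cox.hA0 cox.hAprop, mem_DerMult_iff cox.hA0 cox.hAprop,
    and_iff_right hξ.1, and_iff_right hDξ.1]
  refine forall₂_congr fun a h => ?_
  obtain ⟨g, hgW, hg⟩ := cox.hrefl a h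
  have hDa := simplePoleAt_primitive hDFi hD hDinf.1 h
  have hanti := InvDer.fAct_refl hξ.2 hgW (cox.hA0 a h) hg
  rw [nabDer_linF hpd, neg_sub]
  refine ⟨fun hm => ?_, fun hm => hDa.map_anti hg hanti hm⟩
  obtain ⟨N, hN⟩ := DerInf.exists_pow_mul_mem cox.hA0 cox.hAprop hξ.1 h
  exact hDa.mem_of_map_anti (hpole a h) hg hanti (N := -N) (by rwa [neg_neg, zpow_natCast]) hm

lemma DerMult_anti {m m' : (Fin ℓ → ℝ) → ℤ} (hm : ∀ a, m' a ≤ m a) :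
    DerMult cox.A m ⊆ DerMult cox.A m' := by
  intro ξ hξ
  rw [mem_DerMult_iff cox.hA0 cox.hAprop] at hξ ⊢
  refine ⟨hξ.1, fun a h => ?_⟩
  have h0 := linF_ne_zero (cox.hA0 a h)
  obtain ⟨n, hn⟩ := Int.eq_ofNat_of_zero_le (sub_nonneg.2 (hm a))
  have : linF a ^ (-m' a) = linF a ^ n * linF a ^ (-m a) := by
    rw [← zpow_natCast, ← zpow_add₀ h0]
    congr 1
    have : (n : ℤ) = m a - m' a := hn.symm
    omega
  rw [this, mul_assoc]
  exact mul_mem (pow_mem (toF_mem _) n) (hξ.2 a h)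

end PrimitiveOrders

section Statements

variable {ℓ t : ℕ}

/-- The primitive filtration `R^{(m)}_k = ∇_D^k D(A,m)^W` of `D(A,−∞)^W`, the
`T`-linear automorphism induced by `∇_D` being recorded as a permutation `e`. -/
def RFilt {A : Finset (Fin ℓ → ℝ)} {W : Subgroup (Matrix.GeneralLinearGroup (Fin ℓ) ℝ)}
    (e : Equiv.Perm {ξ : Derivation ℝ (Ffield ℓ) (Ffield ℓ) // ξ ∈ DerInfW A W})
    (m : (Fin ℓ → ℝ) → ℤ) (k : ℤ) : Set (Derivation ℝ (Ffield ℓ) (Ffield ℓ)) :=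
  Subtype.val '' ((e ^ k) ''
    {w : {ξ : Derivation ℝ (Ffield ℓ) (Ffield ℓ) // ξ ∈ DerInfW A W} |
      (w : Derivation ℝ (Ffield ℓ) (Ffield ℓ)) ∈ DerMult A m})

/-- Theorem 4.5: the primitive filtration of `D(A,−∞)^W` is
increasing and `R^{(m)}_k = R^{(m−2k)}_0 = D(A, m−2k)^W`. -/
theorem stmt13 (cox : CoxeterSetup ℓ t)
    (DFi : Fin t → Derivation ℝ (Ffield ℓ) (Ffield ℓ))
    (hDFi : ∀ i c, DFi i (toF (cox.P c)) = if c = cox.top i then 1 else 0)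
    (D : Derivation ℝ (Ffield ℓ) (Ffield ℓ)) (hD : D = ∑ i, DFi i)
    (pd : Fin ℓ → Derivation ℝ (Ffield ℓ) (Ffield ℓ))
    (hpd : ∀ x (p : Spoly ℓ), pd x (toF p) = toF (MvPolynomial.pderiv x p))
    (e : Equiv.Perm {ξ : Derivation ℝ (Ffield ℓ) (Ffield ℓ) // ξ ∈ DerInfW cox.A cox.W})
    (he : ∀ ξ, (e ξ : Derivation ℝ (Ffield ℓ) (Ffield ℓ))
      = nabDer pd D (ξ : Derivation ℝ (Ffield ℓ) (Ffield ℓ)))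
    (m : (Fin ℓ → ℝ) → ℤ) :
    (∀ k : ℤ, RFilt e m k ⊆ RFilt e m (k + 1)) ∧
    (∀ k : ℤ, RFilt e m k = RFilt e (fun a => m a - 2 * k) 0 ∧
      RFilt e m k = DerMultW cox.A cox.W (fun a => m a - 2 * k)) := by
  have hDinf : D ∈ DerInfW cox.A cox.W := by
    have h := (e ⟨eulerDer pd, eulerDer_mem hpd cox.hWorth⟩).2
    rwa [he, nabDer_eulerDer hpd] at h
  have hmap : ∀ ξ ∈ DerInfW cox.A cox.W, nabDer pd D ξ ∈ DerInfW cox.A cox.W := fun ξ hξ =>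
    he ⟨ξ, hξ⟩ ▸ (e ⟨ξ, hξ⟩).2
  have hzero : (0 : Derivation ℝ (Ffield ℓ) (Ffield ℓ)) ∈ DerInfW cox.A cox.W :=
    ⟨⟨0, fun x => ⟨0, by simp⟩, fun _ _ _ _ => ⟨0, by simp⟩⟩, fun g _ => by
      ext x; simp [vecAct, derVec]⟩
  have hinj : ∀ ξ ∈ DerInfW cox.A cox.W, nabDer pd D ξ = 0 → ξ = 0 := by
    intro ξ hξ h0
    have : e ⟨ξ, hξ⟩ = e ⟨0, hzero⟩ := Subtype.ext (by
      rw [he, he, h0]; simp [nabDer])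
    exact congrArg Subtype.val (e.injective this)
  have hstep : ∀ (ξ : {ξ : Derivation ℝ (Ffield ℓ) (Ffield ℓ) // ξ ∈ DerInfW cox.A cox.W})
      (m : (Fin ℓ → ℝ) → ℤ), (e ξ : Derivation ℝ (Ffield ℓ) (Ffield ℓ)) ∈
        DerMult cox.A (fun a => m a - 2) ↔
      (ξ : Derivation ℝ (Ffield ℓ) (Ffield ℓ)) ∈ DerMult cox.A m := by
    intro ξ m
    rw [he]
    exact nabDer_mem_DerMult_iff hDFi hD hpd hDinf
      (fun a h => primitive_linF_notMem hDFi hD hpd hDinf hmap hinj h) ξ.2 (hmap _ ξ.2) m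
  have hpow : ∀ k : ℤ, ∀ ξ : {ξ : Derivation ℝ (Ffield ℓ) (Ffield ℓ) // ξ ∈ DerInfW cox.A cox.W},
      ((e ^ k) ξ : Derivation ℝ (Ffield ℓ) (Ffield ℓ)) ∈ DerMult cox.A (fun a => m a - 2 * k) ↔
      (ξ : Derivation ℝ (Ffield ℓ) (Ffield ℓ)) ∈ DerMult cox.A m := by
    have hsucc : ∀ (k : ℤ)
        (ξ : {ξ : Derivation ℝ (Ffield ℓ) (Ffield ℓ) // ξ ∈ DerInfW cox.A cox.W}),
        ((e ^ (k + 1)) ξ : Derivation ℝ (Ffield ℓ) (Ffield ℓ)) ∈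
          DerMult cox.A (fun a => m a - 2 * (k + 1)) ↔
        ((e ^ k) ξ : Derivation ℝ (Ffield ℓ) (Ffield ℓ)) ∈
          DerMult cox.A (fun a => m a - 2 * k) := by
      intro k ξ
      have hm : (fun a => m a - 2 * (k + 1)) = fun a => m a - 2 * k - 2 := by
        funext a
        ring
      rw [hm, add_comm k 1, zpow_one_add, Equiv.Perm.mul_apply]
      exact hstep ((e ^ k) ξ) fun a => m a - 2 * k
    intro k ξ
    induction k using Int.induction_on with
    | zero => simp
    | succ k ih => rw [hsucc, ih]
    | pred k ih => rw [← hsucc, sub_add_cancel, ih]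
  have hRFilt : ∀ k : ℤ, RFilt e m k = DerMultW cox.A cox.W (fun a => m a - 2 * k) := by
    intro k
    ext ξ
    constructor
    · rintro ⟨_, ⟨w, hw, rfl⟩, rfl⟩
      exact ⟨(hpow k w).2 hw, ((e ^ k) w).2.2⟩
    · rintro ⟨hξ, hW⟩
      refine ⟨⟨ξ, hξ.1, hW⟩, ⟨(e ^ k).symm ⟨ξ, hξ.1, hW⟩, ?_, Equiv.apply_symm_apply _ _⟩, rfl⟩
      refine (hpow k _).1 ?_
      rw [Equiv.apply_symm_apply]
      exact hξ
  refine ⟨fun k => ?_, fun k => ⟨?_, hRFilt k⟩⟩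
  · rw [hRFilt, hRFilt]
    exact fun ξ hξ => ⟨DerMult_anti (fun a => by lia) hξ.1, hξ.2⟩
  · rw [hRFilt]
    ext ξ
    constructor
    · rintro ⟨hξ, hW⟩
      exact ⟨⟨ξ, hξ.1, hW⟩, ⟨⟨ξ, hξ.1, hW⟩, hξ, by simp⟩, rfl⟩
    · rintro ⟨_, ⟨w, hw, rfl⟩, rfl⟩
      rw [zpow_zero, Equiv.Perm.one_apply]
      exact ⟨hw, w.2.2⟩

end Statements
end

section
/- Let A be a (not necessarily irreducible) Coxeter arrangement with Coxeter group W. Then the W-invariant logarithmic forms exhaust over the odd constant multiplicities: Ω(A,∞)^W = ∪_{k∈ℤ} Ω(A, 2k−1)^W. -/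
open MvPolynomial

section Statements

variable {ℓ t : ℕ}

/-- If `Q^N ω` is regular then `ω` lies in `Ω(A, 2(N+1) - 1)`: the pole order of `I*(dα_H, ω)`
along `H` is at most `N`. -/
lemma exists_mem_OmegaMult_odd {A : Finset (Fin ℓ → ℝ)} {ω : OmF ℓ} (hω : ω ∈ OmegaInf A) :
    ∃ k : ℤ, ω ∈ OmegaMult A fun _ => 2 * k - 1 := by
  obtain ⟨N, hN, -⟩ := id hω
  choose p hp using hN
  refine ⟨N + 1, hω, N, fun a _ => ?_⟩
  have hexp : (2 * ((N : ℤ) + 1) - 1) = ((N + (N + 1) : ℕ) : ℤ) := by push_cast; ring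
  simp only [hexp, zpow_natCast]
  refine ⟨linForm a ^ (N + 1) * ∑ x, MvPolynomial.C (a x) * p x, ?_⟩
  by_cases h0 : linF a = 0
  · have h1 : algebraMap (Spoly ℓ) (Ffield ℓ) (linForm a) = 0 := h0
    simp [h0, h1]
  · have hQ : (QF A / linF a) ^ N * linF a ^ (N + (N + 1)) = linF a ^ (N + 1) * QF A ^ N := by
      rw [pow_add, ← mul_assoc, ← mul_pow, div_mul_cancel₀ _ h0, mul_comm]
    rw [hQ, map_mul, map_pow, map_sum, mul_assoc, Finset.mul_sum Finset.univ _ (QF A ^ N)]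
    refine congrArg (linF a ^ (N + 1) * ·) (Finset.sum_congr rfl fun x _ => ?_)
    rw [map_mul, hp]
    exact mul_left_comm _ _ _

/-- `Ω(A,∞)^W = ∪_{k ∈ ℤ} Ω(A, 2k−1)^W`. -/
theorem stmt18 (cox : CoxeterSetup ℓ t) :
    OmegaInfW cox.A cox.W = ⋃ k : ℤ, OmegaMultW cox.A cox.W fun _ => 2 * k - 1 := by
  ext ω
  simp only [OmegaInfW, OmegaMultW, Set.mem_iUnion, Set.mem_inter_iff]
  constructor
  · rintro ⟨hω, hW⟩
    obtain ⟨k, hk⟩ := exists_mem_OmegaMult_odd hω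
    exact ⟨k, hk, hW⟩
  · rintro ⟨k, hk, hW⟩
    exact ⟨hk.1, hW⟩

end Statements
end
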